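/- arXiv:2602.04828 — 7 statements merged into one kernel-verified Lean document; each statement's English description precedes it below -/
import Mathlib

section
/- Let σ > 0, C > 0, 0 < β, and 0 < α < min(β, 1). Let Λ = {λ_k}_{k≥1} be a sequence of complex numbers contained in the domain {z ∈ ℂ : Im z < 0 and −Im z ≥ C·|z|^β}, whose counting function n(r) = #{k : |λ_k| ≤ r} satisfies n(r) ≤ K·r^α for all r > 0 and some K > 0. Then there exists a function g in the Paley–Wiener space PW_σ such that g(0) = 0 and g(λ) = λ·exp(−iσλ) for every λ ∈ Λ. -/
open MeasureTheory

noncomputable section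

/-- An entire function has exponential type at most `σ`. -/
def ExpTypeLE (σ : ℝ) (g : ℂ → ℂ) : Prop :=
  ∀ ε : ℝ, 0 < ε → ∃ c : ℝ, 0 < c ∧ ∀ z : ℂ, ‖g z‖ ≤ c * Real.exp ((σ + ε) * ‖z‖)

/-- Membership in the Paley–Wiener space `PW_σ`: entire, of exponential type at most `σ`,
and square-integrable on the real line. -/
def MemPW (σ : ℝ) (g : ℂ → ℂ) : Prop :=
  Differentiable ℂ g ∧ ExpTypeLE σ g ∧
    MeasureTheory.Integrable (fun x : ℝ => ‖g x‖ ^ 2)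

section

open Filter Topology

/-- Locally uniformly absolutely convergent products of entire functions are entire. -/
theorem differentiable_tprod_one_add {f : ℕ → ℂ → ℂ} {u : ℕ → ℝ} (hu : Summable u)
    (hf : ∀ k, Differentiable ℂ (f k))
    (hb : ∀ R : ℝ, ∃ B : ℝ, ∀ k z, ‖z‖ ≤ R → ‖f k z‖ ≤ B * u k) :
    Differentiable ℂ (fun z => ∏' k, (1 + f k z)) := by
  intro z
  obtain ⟨B, hB⟩ := hb (‖z‖ + 1)
  have h := Summable.hasProdLocallyUniformlyOn_nat_one_add (f := f)
    (Metric.isOpen_ball (x := (0 : ℂ)) (ε := ‖z‖ + 1)) (hu.mul_left B)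
    (Eventually.of_forall fun k w hw => hB k w (by simpa using (le_of_lt (mem_ball_zero_iff.1 hw))))
    (fun k => (hf k).continuous.continuousOn)
  have h2 := (hasProdLocallyUniformlyOn_iff_tendstoLocallyUniformlyOn.1 h).differentiableOn
    (Eventually.of_forall fun s => by
      refine DifferentiableOn.fun_finsetProd fun i _ => ?_
      exact ((hf i).const_add 1).differentiableOn) Metric.isOpen_ball
  exact h2.differentiableAt (Metric.isOpen_ball.mem_nhds (by simp))

theorem norm_tprod_le_exp {f : ℕ → ℂ} {v : ℕ → ℝ} (hf : Multipliable f) (hv : Summable v)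
    (h : ∀ k, ‖f k‖ ≤ Real.exp (v k)) : ‖∏' k, f k‖ ≤ Real.exp (∑' k, v k) := by
  refine le_of_tendsto_of_tendsto' hf.hasProd.norm hv.hasSum.rexp fun s => ?_
  exact Finset.prod_le_prod (fun _ _ => norm_nonneg _) (fun k _ => h k)

theorem exp_le_norm_tprod {f : ℕ → ℂ} {v : ℕ → ℝ} (hf : Multipliable f) (hv : Summable v)
    (h : ∀ k, Real.exp (v k) ≤ ‖f k‖) : Real.exp (∑' k, v k) ≤ ‖∏' k, f k‖ := by
  refine le_of_tendsto_of_tendsto' hv.hasSum.rexp hf.hasProd.norm fun s => ?_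
  exact Finset.prod_le_prod (fun _ _ => (Real.exp_pos _).le) (fun k _ => h k)

/-- A smaller power is absorbed by a larger one. -/
theorem exists_mul_one_add_rpow_le {p q A b : ℝ} (hp : 0 < p) (hpq : p < q) (hA : 0 ≤ A)
    (hb : 0 < b) : ∃ M : ℝ, ∀ t : ℝ, 0 ≤ t → A * (1 + t) ^ p ≤ b * t ^ q + M := by
  have h2 : Tendsto (fun t : ℝ => t ^ (q - p)) atTop atTop := tendsto_rpow_atTop (by linarith)
  obtain ⟨T, hT⟩ := eventually_atTop.1 (h2.eventually_ge_atTop (A * 2 ^ p / b))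
  refine ⟨A * (1 + max T 1) ^ p, fun t ht => ?_⟩
  rcases le_total t (max T 1) with h | h
  · have : A * (1 + t) ^ p ≤ A * (1 + max T 1) ^ p := by gcongr
    have : 0 ≤ b * t ^ q := by positivity
    linarith
  · have h1 : 1 ≤ t := (le_max_right _ _).trans h
    have h3 := hT t ((le_max_left _ _).trans h)
    rw [div_le_iff₀ hb] at h3
    have h4 : A * (1 + t) ^ p ≤ A * (2 * t) ^ p := by gcongr; linarith
    rw [Real.mul_rpow (by norm_num) ht] at h4
    have h5 : t ^ q = t ^ (q - p) * t ^ p := by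
      rw [← Real.rpow_add (by linarith)]; ring_nf
    have h6 : 0 ≤ A * (1 + max T 1) ^ p := by positivity
    have h7 : 0 ≤ t ^ p := by positivity
    rw [h5]
    nlinarith [mul_le_mul_of_nonneg_right h3 h7]

theorem one_add_le_exp_rpow {u p : ℝ} (hu : 0 ≤ u) (hp : 0 < p) (hp1 : p ≤ 1) :
    1 + u ≤ Real.exp (u ^ p / p) := by
  have h1 : (1 + u) ^ p ≤ 1 + u ^ p := by
    simpa using Real.rpow_add_le_add_rpow (zero_le_one) hu hp.le hp1
  have h2 : 1 + u ^ p ≤ Real.exp (u ^ p) := by linarith [Real.add_one_le_exp (u ^ p)]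
  have h3 := Real.rpow_le_rpow (by positivity) (h1.trans h2) (by positivity : 0 ≤ 1 / p)
  rw [← Real.rpow_mul (by positivity), ← Real.exp_mul] at h3
  simpa [hp.ne', div_eq_mul_inv] using h3

/-- The convergence exponent is at most the order of the counting function. -/
theorem summable_rpow_neg_of_ncard_le {K α γ c₀ : ℝ} (hK : 0 < K) (hαγ : α < γ)
    (hγ : 0 < γ) (hc₀ : 0 < c₀) {l : ℕ → ℝ} (hl : ∀ k, c₀ ≤ l k)
    (hcount : ∀ r : ℝ, 0 < r → {k : ℕ | l k ≤ r}.Finite ∧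
      ({k : ℕ | l k ≤ r}.ncard : ℝ) ≤ K * r ^ α) :
    Summable (fun k => l k ^ (-γ)) := by
  classical
  have hl0 : ∀ k, 0 < l k := fun k => hc₀.trans_le (hl k)
  set m : ℕ → ℕ := fun k => Nat.ceil (Real.logb 2 (l k)) with hm
  have hle : ∀ k, l k ≤ 2 ^ (m k : ℝ) := fun k => by
    rw [← Real.logb_le_iff_le_rpow (by norm_num) (hl0 k)]
    exact Nat.le_ceil _
  set C₀ := max (2 ^ γ) (c₀ ^ (-γ)) with hC₀
  have hC₀0 : 0 < C₀ := lt_max_of_lt_left (by positivity)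
  have hbd : ∀ k, l k ^ (-γ) ≤ C₀ * 2 ^ (-γ * (m k : ℝ)) := fun k => by
    rcases Nat.eq_zero_or_pos (m k) with h0 | h0
    · rw [h0]
      simp only [Nat.cast_zero, mul_zero, Real.rpow_zero, mul_one]
      exact (Real.rpow_le_rpow_of_nonpos hc₀ (hl k) (by linarith)).trans (le_max_right _ _)
    · have h1 : (m k : ℝ) < Real.logb 2 (l k) + 1 := by
        refine Nat.ceil_lt_add_one ?_
        exact (Nat.ceil_pos.1 h0).le
      have h2 : (2 : ℝ) ^ ((m k : ℝ) - 1) ≤ l k := by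
        rw [← Real.le_logb_iff_rpow_le (by norm_num) (hl0 k)]; linarith
      refine (Real.rpow_le_rpow_of_nonpos (by positivity) h2 (by linarith)).trans ?_
      rw [← Real.rpow_mul (by norm_num)]
      have : ((m k : ℝ) - 1) * -γ = γ + -γ * m k := by ring
      rw [this, Real.rpow_add (by norm_num)]
      gcongr
      exact le_max_left _ _
  have hgeo : Summable (fun n : ℕ => C₀ * K * ((2 : ℝ) ^ (α - γ)) ^ n) := by
    refine (summable_geometric_of_lt_one (by positivity) ?_).mul_left _
    exact Real.rpow_lt_one_of_one_lt_of_neg (by norm_num) (by linarith)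
  refine summable_of_sum_le (fun k => Real.rpow_nonneg (hl0 k).le _)
    (c := ∑' n : ℕ, C₀ * K * ((2 : ℝ) ^ (α - γ)) ^ n) fun u => ?_
  rw [← Finset.sum_fiberwise_of_maps_to (t := u.image m) (g := m)
    (fun k hk => Finset.mem_image_of_mem m hk)]
  refine le_trans (Finset.sum_le_sum fun n _ => ?_)
    (hgeo.sum_le_tsum (u.image m) fun n _ => by positivity)
  obtain ⟨hfin, hcard⟩ := hcount (2 ^ (n : ℝ)) (by positivity)
  have h1 : ∑ k ∈ u with m k = n, l k ^ (-γ)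
      ≤ (Finset.card {k ∈ u | m k = n}) • (C₀ * 2 ^ (-γ * (n : ℝ))) := by
    refine Finset.sum_le_card_nsmul _ _ _ fun k hk => ?_
    have := (Finset.mem_filter.1 hk).2
    rw [← this]; exact hbd k
  have h2 : ((Finset.card {k ∈ u | m k = n} : ℕ) : ℝ) ≤ K * (2 ^ (n : ℝ)) ^ α := by
    refine le_trans ?_ hcard
    have hsub : ((Finset.filter (fun k => m k = n) u : Finset ℕ) : Set ℕ)
        ⊆ {k : ℕ | l k ≤ 2 ^ (n : ℝ)} := fun k hk => by
      have h3 := (Finset.mem_filter.1 (Finset.mem_coe.1 hk)).2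
      have h4 := hle k
      rwa [h3] at h4
    have h5 := Set.ncard_le_ncard hsub hfin
    rw [Set.ncard_coe_finset] at h5
    exact Nat.cast_le.2 h5
  refine h1.trans ?_
  rw [nsmul_eq_mul]
  refine (mul_le_mul_of_nonneg_right h2 (by positivity)).trans (le_of_eq ?_)
  rw [← Real.rpow_mul (by norm_num), ← Real.rpow_mul_natCast (by norm_num)]
  have : (α - γ) * (n : ℝ) = n * α + -γ * n := by ring
  rw [this, Real.rpow_add (by norm_num)]
  ring

/-- Counterclockwise integral over the boundary of the rectangle `[x₀, x₁] × [y₀, y₁]`. -/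
def rectIntegral (f : ℂ → ℂ) (x₀ x₁ y₀ y₁ : ℝ) : ℂ :=
  (∫ x : ℝ in x₀..x₁, f (x + y₀ * Complex.I)) - (∫ x : ℝ in x₀..x₁, f (x + y₁ * Complex.I)) +
    Complex.I * (∫ y : ℝ in y₀..y₁, f (x₁ + y * Complex.I)) -
    Complex.I * (∫ y : ℝ in y₀..y₁, f (x₀ + y * Complex.I))

/-- The boundary of the rectangle `[x₀, x₁] × [y₀, y₁]`. -/
def rectBoundary (x₀ x₁ y₀ y₁ : ℝ) : Set ℂ :=
  {w | w ∈ Set.Icc x₀ x₁ ×ℂ Set.Icc y₀ y₁ ∧ (w.re = x₀ ∨ w.re = x₁ ∨ w.im = y₀ ∨ w.im = y₁)}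

section

variable {x₀ x₁ y₀ y₁ : ℝ}

theorem mem_rectBoundary_bottom (hy : y₀ ≤ y₁) {x : ℝ} (h : x ∈ Set.Icc x₀ x₁) :
    (x + y₀ * Complex.I : ℂ) ∈ rectBoundary x₀ x₁ y₀ y₁ := by
  simp [rectBoundary, Complex.mem_reProdIm, h.1, h.2, hy]

theorem mem_rectBoundary_top (hy : y₀ ≤ y₁) {x : ℝ} (h : x ∈ Set.Icc x₀ x₁) :
    (x + y₁ * Complex.I : ℂ) ∈ rectBoundary x₀ x₁ y₀ y₁ := by
  simp [rectBoundary, Complex.mem_reProdIm, h.1, h.2, hy]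

theorem mem_rectBoundary_right (hx : x₀ ≤ x₁) {y : ℝ} (h : y ∈ Set.Icc y₀ y₁) :
    (x₁ + y * Complex.I : ℂ) ∈ rectBoundary x₀ x₁ y₀ y₁ := by
  simp [rectBoundary, Complex.mem_reProdIm, h.1, h.2, hx]

theorem mem_rectBoundary_left (hx : x₀ ≤ x₁) {y : ℝ} (h : y ∈ Set.Icc y₀ y₁) :
    (x₀ + y * Complex.I : ℂ) ∈ rectBoundary x₀ x₁ y₀ y₁ := by
  simp [rectBoundary, Complex.mem_reProdIm, h.1, h.2, hx]

theorem rectIntegral_congr (hx : x₀ ≤ x₁) (hy : y₀ ≤ y₁) {f g : ℂ → ℂ}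
    (h : Set.EqOn f g (rectBoundary x₀ x₁ y₀ y₁)) :
    rectIntegral f x₀ x₁ y₀ y₁ = rectIntegral g x₀ x₁ y₀ y₁ := by
  have e1 := intervalIntegral.integral_congr (μ := volume)
    (fun x (hm : x ∈ Set.uIcc x₀ x₁) =>
      h (mem_rectBoundary_bottom hy (by rwa [Set.uIcc_of_le hx] at hm)))
  have e2 := intervalIntegral.integral_congr (μ := volume)
    (fun x (hm : x ∈ Set.uIcc x₀ x₁) =>
      h (mem_rectBoundary_top hy (by rwa [Set.uIcc_of_le hx] at hm)))
  have e3 := intervalIntegral.integral_congr (μ := volume)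
    (fun y (hm : y ∈ Set.uIcc y₀ y₁) =>
      h (mem_rectBoundary_right hx (by rwa [Set.uIcc_of_le hy] at hm)))
  have e4 := intervalIntegral.integral_congr (μ := volume)
    (fun y (hm : y ∈ Set.uIcc y₀ y₁) =>
      h (mem_rectBoundary_left hx (by rwa [Set.uIcc_of_le hy] at hm)))
  simp only [rectIntegral, e1, e2, e3, e4]

theorem norm_rectIntegral_le (hx : x₀ ≤ x₁) (hy : y₀ ≤ y₁) {f : ℂ → ℂ} {M : ℝ}
    (h : ∀ w ∈ rectBoundary x₀ x₁ y₀ y₁, ‖f w‖ ≤ M) :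
    ‖rectIntegral f x₀ x₁ y₀ y₁‖ ≤ M * (2 * ((x₁ - x₀) + (y₁ - y₀))) := by
  have hx' : |x₁ - x₀| = x₁ - x₀ := abs_of_nonneg (by linarith)
  have hy' : |y₁ - y₀| = y₁ - y₀ := abs_of_nonneg (by linarith)
  have e1 := intervalIntegral.norm_integral_le_of_norm_le_const (fun x (hm : x ∈ Set.uIoc x₀ x₁) =>
      h _ (mem_rectBoundary_bottom hy (Set.Ioc_subset_Icc_self (by rwa [Set.uIoc_of_le hx] at hm))))
  have e2 := intervalIntegral.norm_integral_le_of_norm_le_const (fun x (hm : x ∈ Set.uIoc x₀ x₁) =>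
      h _ (mem_rectBoundary_top hy (Set.Ioc_subset_Icc_self (by rwa [Set.uIoc_of_le hx] at hm))))
  have e3 := intervalIntegral.norm_integral_le_of_norm_le_const (fun x (hm : x ∈ Set.uIoc y₀ y₁) =>
      h _ (mem_rectBoundary_right hx (Set.Ioc_subset_Icc_self (by rwa [Set.uIoc_of_le hy] at hm))))
  have e4 := intervalIntegral.norm_integral_le_of_norm_le_const (fun x (hm : x ∈ Set.uIoc y₀ y₁) =>
      h _ (mem_rectBoundary_left hx (Set.Ioc_subset_Icc_self (by rwa [Set.uIoc_of_le hy] at hm))))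
  rw [hx'] at e1 e2
  rw [hy'] at e3 e4
  unfold rectIntegral
  refine (norm_sub_le _ _).trans ?_
  refine (add_le_add_left ((norm_add_le _ _).trans
    (add_le_add_left (norm_sub_le _ _) _)) _).trans ?_
  simp only [norm_mul, Complex.norm_I, one_mul]
  linarith

theorem rectIntegral_eq_zero (hx : x₀ ≤ x₁) (hy : y₀ ≤ y₁) {f : ℂ → ℂ}
    (h : DifferentiableOn ℂ f (Set.Icc x₀ x₁ ×ℂ Set.Icc y₀ y₁)) :
    rectIntegral f x₀ x₁ y₀ y₁ = 0 := by
  have := Complex.integral_boundary_rect_eq_zero_of_differentiableOn f ⟨x₀, y₀⟩ ⟨x₁, y₁⟩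
    (by simpa [Set.uIcc_of_le hx, Set.uIcc_of_le hy] using h)
  simpa [rectIntegral] using this

theorem rectIntegral_add (hx : x₀ ≤ x₁) (hy : y₀ ≤ y₁) {f g : ℂ → ℂ}
    (hf : ContinuousOn f (rectBoundary x₀ x₁ y₀ y₁))
    (hg : ContinuousOn g (rectBoundary x₀ x₁ y₀ y₁)) :
    rectIntegral (fun w => f w + g w) x₀ x₁ y₀ y₁ =
      rectIntegral f x₀ x₁ y₀ y₁ + rectIntegral g x₀ x₁ y₀ y₁ := by
  have i1 : ∀ f : ℂ → ℂ, ContinuousOn f (rectBoundary x₀ x₁ y₀ y₁) →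
      IntervalIntegrable (fun x : ℝ => f (x + y₀ * Complex.I)) volume x₀ x₁ := fun f hf =>
    (ContinuousOn.comp hf (by fun_prop) fun x hm =>
      mem_rectBoundary_bottom hy (by rwa [Set.uIcc_of_le hx] at hm)).intervalIntegrable
  have i2 : ∀ f : ℂ → ℂ, ContinuousOn f (rectBoundary x₀ x₁ y₀ y₁) →
      IntervalIntegrable (fun x : ℝ => f (x + y₁ * Complex.I)) volume x₀ x₁ := fun f hf =>
    (ContinuousOn.comp hf (by fun_prop) fun x hm =>
      mem_rectBoundary_top hy (by rwa [Set.uIcc_of_le hx] at hm)).intervalIntegrable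
  have i3 : ∀ f : ℂ → ℂ, ContinuousOn f (rectBoundary x₀ x₁ y₀ y₁) →
      IntervalIntegrable (fun y : ℝ => f (x₁ + y * Complex.I)) volume y₀ y₁ := fun f hf =>
    (ContinuousOn.comp hf (by fun_prop) fun x hm =>
      mem_rectBoundary_right hx (by rwa [Set.uIcc_of_le hy] at hm)).intervalIntegrable
  have i4 : ∀ f : ℂ → ℂ, ContinuousOn f (rectBoundary x₀ x₁ y₀ y₁) →
      IntervalIntegrable (fun y : ℝ => f (x₀ + y * Complex.I)) volume y₀ y₁ := fun f hf =>
    (ContinuousOn.comp hf (by fun_prop) fun x hm =>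
      mem_rectBoundary_left hx (by rwa [Set.uIcc_of_le hy] at hm)).intervalIntegrable
  simp only [rectIntegral]
  rw [intervalIntegral.integral_add (i1 f hf) (i1 g hg),
    intervalIntegral.integral_add (i2 f hf) (i2 g hg),
    intervalIntegral.integral_add (i3 f hf) (i3 g hg),
    intervalIntegral.integral_add (i4 f hf) (i4 g hg)]
  ring

theorem rectIntegral_const_mul (c : ℂ) (f : ℂ → ℂ) :
    rectIntegral (fun w => c * f w) x₀ x₁ y₀ y₁ = c * rectIntegral f x₀ x₁ y₀ y₁ := by
  simp only [rectIntegral, intervalIntegral.integral_const_mul]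
  ring

theorem log_I_mul_of_re_pos_of_im_neg {v : ℂ} (hr : 0 < v.re) (hi : v.im < 0) :
    Complex.log (Complex.I * v) = Real.pi / 2 * Complex.I + Complex.log v := by
  have hv : v ≠ 0 := fun h => by simp [h] at hr
  rw [← Complex.log_I]
  refine (Complex.log_mul_eq_add_log_iff Complex.I_ne_zero hv).2 ?_
  rw [Complex.arg_I]
  have h1 := Complex.arg_neg_iff.2 hi
  have h2 := Complex.neg_pi_lt_arg v
  constructor <;> linarith [Real.pi_pos]

/-- Integral of `1 / (x - q)` along a horizontal or vertical segment off the branch cut of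
`log (c * ·)`. -/
theorem integral_inv_segment {a b : ℝ} {c d q : ℂ} (hab : a ≤ b)
    (hs : ∀ t ∈ Set.Icc a b, c * (d * t + q) ∈ Complex.slitPlane) :
    d * ∫ t : ℝ in a..b, (d * t + q)⁻¹ =
      Complex.log (c * (d * b + q)) - Complex.log (c * (d * a + q)) := by
  have hc : c ≠ 0 := fun h => by
    have := hs a ⟨le_rfl, hab⟩
    simp [h] at this
  have hne : ∀ t ∈ Set.Icc a b, d * (t : ℂ) + q ≠ 0 := fun t ht h => by
    have := hs t ht
    simp [h] at this
  rw [← intervalIntegral.integral_const_mul]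
  refine intervalIntegral.integral_eq_sub_of_hasDerivAt
    (f := fun t : ℝ => Complex.log (c * (d * t + q))) (fun t ht => ?_) ?_
  · rw [Set.uIcc_of_le hab] at ht
    have h1 : HasDerivAt (fun t : ℝ => c * (d * (t : ℂ) + q)) (c * (d * 1)) t :=
      ((Complex.ofRealCLM.hasDerivAt.const_mul d).add_const q).const_mul c
    have h2 := h1.clog_real (hs t ht)
    rwa [mul_one, mul_div_mul_left _ _ hc, div_eq_mul_inv] at h2
  · refine ContinuousOn.intervalIntegrable ?_
    rw [Set.uIcc_of_le hab]
    exact continuousOn_const.mul (ContinuousOn.inv₀ (by fun_prop) hne)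

theorem rectIntegral_sub_inv {p : ℂ} (hp : p ∈ Set.Ioo x₀ x₁ ×ℂ Set.Ioo y₀ y₁) :
    rectIntegral (fun w => (w - p)⁻¹) x₀ x₁ y₀ y₁ = 2 * Real.pi * Complex.I := by
  obtain ⟨⟨hx0, hx1⟩, hy0, hy1⟩ := hp
  have hx : x₀ ≤ x₁ := (hx0.trans hx1).le
  have hy : y₀ ≤ y₁ := (hy0.trans hy1).le
  have e1 := integral_inv_segment (c := Complex.I) (d := 1) (q := y₀ * Complex.I - p) hx
    (fun t ht => Or.inl (by simpa using hy0))
  have e2 := integral_inv_segment (c := -Complex.I) (d := 1) (q := y₁ * Complex.I - p) hx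
    (fun t ht => Or.inl (by simpa using hy1))
  have e3 := integral_inv_segment (c := 1) (d := Complex.I) (q := x₁ - p) hy
    (fun t ht => Or.inl (by simpa using hx1))
  have e4 := integral_inv_segment (c := -1) (d := Complex.I) (q := x₀ - p) hy
    (fun t ht => Or.inl (by simpa using hx0))
  have c1 := log_I_mul_of_re_pos_of_im_neg (v := x₁ + y₀ * Complex.I - p)
    (by simpa using hx1) (by simpa using hy0)
  have c2 := log_I_mul_of_re_pos_of_im_neg (v := -Complex.I * (x₁ + y₁ * Complex.I - p))
    (by simpa using hy1) (by simpa using hx1)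
  have c3 := log_I_mul_of_re_pos_of_im_neg (v := -(x₀ + y₁ * Complex.I - p))
    (by simpa using hx0) (by simpa using hy1)
  have c4 := log_I_mul_of_re_pos_of_im_neg (v := Complex.I * (x₀ + y₀ * Complex.I - p))
    (by simpa using hy0) (by simpa using hx0)
  have n1 : ∀ t : ℝ, (t + y₀ * Complex.I - p : ℂ) = t + (y₀ * Complex.I - p) := fun t => by ring
  have n2 : ∀ t : ℝ, (t + y₁ * Complex.I - p : ℂ) = t + (y₁ * Complex.I - p) := fun t => by ring
  have n3 : ∀ t : ℝ, (x₁ + t * Complex.I - p : ℂ) = Complex.I * t + (x₁ - p) := fun t => by ring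
  have n4 : ∀ t : ℝ, (x₀ + t * Complex.I - p : ℂ) = Complex.I * t + (x₀ - p) := fun t => by ring
  simp only [one_mul] at e1 e2 e3 e4
  simp only [← n1, ← n2, ← n3, ← n4] at e1 e2 e3 e4
  simp only [rectIntegral]
  rw [e1, e2, e3, e4]
  have d2 : Complex.I * (-Complex.I * (x₁ + y₁ * Complex.I - p)) = x₁ + y₁ * Complex.I - p := by
    linear_combination (-(x₁ + y₁ * Complex.I - p)) * Complex.I_mul_I
  have d3 : Complex.I * -(x₀ + y₁ * Complex.I - p) = -Complex.I * (x₀ + y₁ * Complex.I - p) := by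
    ring
  have d4 : Complex.I * (Complex.I * (x₀ + y₀ * Complex.I - p)) = -1 * (x₀ + y₀ * Complex.I - p) := by
    linear_combination (x₀ + y₀ * Complex.I - p) * Complex.I_mul_I
  have d5 : -(x₀ + y₁ * Complex.I - p) = -1 * (x₀ + y₁ * Complex.I - p) := by ring
  rw [d2] at c2
  rw [d3, d5] at c3
  rw [d4] at c4
  rw [c1, c2, c3, c4]
  ring

/-- **Cauchy integral formula** for a rectangle. -/
theorem rectIntegral_div_sub {p : ℂ} (hp : p ∈ Set.Ioo x₀ x₁ ×ℂ Set.Ioo y₀ y₁) {h : ℂ → ℂ}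
    {U : Set ℂ} (hU : IsOpen U) (hR : Set.Icc x₀ x₁ ×ℂ Set.Icc y₀ y₁ ⊆ U)
    (hd : DifferentiableOn ℂ h U) :
    rectIntegral (fun w => h w / (w - p)) x₀ x₁ y₀ y₁ = 2 * Real.pi * Complex.I * h p := by
  have hp' := hp
  obtain ⟨⟨hx0, hx1⟩, hy0, hy1⟩ := hp'
  have hx : x₀ ≤ x₁ := (hx0.trans hx1).le
  have hy : y₀ ≤ y₁ := (hy0.trans hy1).le
  have hpU : p ∈ U := hR ⟨⟨hx0.le, hx1.le⟩, hy0.le, hy1.le⟩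
  have hne : ∀ w ∈ rectBoundary x₀ x₁ y₀ y₁, w - p ≠ 0 := by
    rintro w ⟨-, hw⟩ h0
    rw [sub_eq_zero] at h0
    subst h0
    rcases hw with h | h | h | h <;> linarith
  have hds : DifferentiableOn ℂ (dslope h p) (Set.Icc x₀ x₁ ×ℂ Set.Icc y₀ y₁) :=
    ((Complex.differentiableOn_dslope (hU.mem_nhds hpU)).2 hd).mono hR
  have hbR : rectBoundary x₀ x₁ y₀ y₁ ⊆ Set.Icc x₀ x₁ ×ℂ Set.Icc y₀ y₁ := fun w hw => hw.1
  rw [rectIntegral_congr hx hy (g := fun w => dslope h p w + h p * (w - p)⁻¹),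
    rectIntegral_add hx hy (hds.continuousOn.mono hbR), rectIntegral_eq_zero hx hy hds,
    rectIntegral_const_mul, rectIntegral_sub_inv hp]
  · ring
  · exact continuousOn_const.mul (ContinuousOn.inv₀ (by fun_prop) hne)
  · intro w hw
    have := hne w hw
    simp only
    rw [dslope_of_ne _ (sub_ne_zero.1 this), slope_def_field]
    field_simp
    ring

end

/-- Integrals of families of entire functions over a segment are entire. -/
theorem differentiable_integral_param {a b : ℝ} (hab : a ≤ b) {f : ℂ → ℝ → ℂ}
    (hc : ∀ z, ContinuousOn (f z) (Set.Icc a b))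
    (hd : ∀ t ∈ Set.Icc a b, Differentiable ℂ (fun z => f z t))
    (hb : ∀ R : ℝ, ∃ B : ℝ, ∀ z, ‖z‖ ≤ R → ∀ t ∈ Set.Icc a b, ‖f z t‖ ≤ B) :
    Differentiable ℂ (fun z => ∫ t in a..b, f z t) := by
  intro z₀
  obtain ⟨B, hB⟩ := hb (‖z₀‖ + 2)
  have hsub : Set.uIoc a b ⊆ Set.Icc a b := by
    rw [Set.uIoc_of_le hab]; exact Set.Ioc_subset_Icc_self
  have hmeas : ∀ z, AEStronglyMeasurable (f z) (volume.restrict (Set.uIoc a b)) := fun z =>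
    ((hc z).mono hsub).aestronglyMeasurable measurableSet_uIoc
  have hderiv : ∀ t ∈ Set.Icc a b, ∀ z, HasDerivAt (fun z => f z t) (deriv (fun z => f z t) z) z :=
    fun t ht z => (hd t ht z).hasDerivAt
  refine (intervalIntegral.hasDerivAt_integral_of_dominated_loc_of_deriv_le
    (F' := fun z t => deriv (fun z => f z t) z) (bound := fun _ => B)
    (Metric.ball_mem_nhds z₀ one_pos) (Eventually.of_forall hmeas) ?_ ?_ ?_ ?_ ?_).2.differentiableAt
  · refine ContinuousOn.intervalIntegrable ?_
    rw [Set.uIcc_of_le hab]; exact hc z₀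
  · refine aestronglyMeasurable_of_tendsto_ae atTop
      (f := fun (n : ℕ) t => ((n : ℂ) + 1) * (f (z₀ + 1 / ((n : ℂ) + 1)) t - f z₀ t))
      (fun n => ((hmeas _).sub (hmeas _)).const_mul _) ?_
    refine (ae_restrict_iff' measurableSet_uIoc).2 (Eventually.of_forall fun t ht => ?_)
    have h1 := (hasDerivAt_iff_tendsto_slope_zero.1 (hderiv t (hsub ht) z₀))
    have h2 : Tendsto (fun n : ℕ => 1 / ((n : ℂ) + 1)) atTop (𝓝[≠] 0) := by
      refine tendsto_nhdsWithin_iff.2 ⟨tendsto_one_div_add_atTop_nhds_zero_nat, ?_⟩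
      exact Eventually.of_forall fun n => one_div_ne_zero (Nat.cast_add_one_ne_zero n)
    refine (h1.comp h2).congr fun n => ?_
    simp
  · refine Eventually.of_forall fun t ht z hz => ?_
    have := Complex.norm_deriv_le_of_forall_mem_sphere_norm_le (c := z) (R := 1) (C := B) one_pos
      (hd t (hsub ht)).diffContOnCl (fun w hw => hB w ?_ t (hsub ht))
    · simpa using this
    · have h1 : ‖w - z‖ = 1 := by simpa [dist_eq_norm] using hw
      have h2 : ‖z - z₀‖ < 1 := by simpa [dist_eq_norm] using hz
      have : w = (w - z) + (z - z₀) + z₀ := by ring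
      rw [this]
      refine (norm_add₃_le).trans ?_
      linarith
  · exact intervalIntegrable_const
  · exact Eventually.of_forall fun t ht z _ => hderiv t (hsub ht) z

theorem differentiable_rectIntegral_param {x₀ x₁ y₀ y₁ : ℝ} (hx : x₀ ≤ x₁) (hy : y₀ ≤ y₁)
    {f : ℂ → ℂ → ℂ} (hc : ∀ z, ContinuousOn (f z) (rectBoundary x₀ x₁ y₀ y₁))
    (hd : ∀ w ∈ rectBoundary x₀ x₁ y₀ y₁, Differentiable ℂ (fun z => f z w))
    (hb : ∀ R : ℝ, ∃ B : ℝ, ∀ z, ‖z‖ ≤ R → ∀ w ∈ rectBoundary x₀ x₁ y₀ y₁, ‖f z w‖ ≤ B) :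
    Differentiable ℂ (fun z => rectIntegral (f z) x₀ x₁ y₀ y₁) := by
  have key : ∀ {a b : ℝ} (_ : a ≤ b) (e : ℝ → ℂ), Continuous e →
      (∀ t ∈ Set.Icc a b, e t ∈ rectBoundary x₀ x₁ y₀ y₁) →
      Differentiable ℂ (fun z => ∫ t in a..b, f z (e t)) := fun hab e he hm =>
    differentiable_integral_param hab (fun z => (hc z).comp he.continuousOn hm)
      (fun t ht => hd _ (hm t ht)) fun R => by
        obtain ⟨B, hB⟩ := hb R
        exact ⟨B, fun z hz t ht => hB z hz _ (hm t ht)⟩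
  unfold rectIntegral
  refine Differentiable.sub (Differentiable.add (Differentiable.sub ?_ ?_) ?_) ?_
  · exact key hx _ (by fun_prop) fun t ht => mem_rectBoundary_bottom hy ht
  · exact key hx _ (by fun_prop) fun t ht => mem_rectBoundary_top hy ht
  · exact (key hy _ (by fun_prop) fun t ht => mem_rectBoundary_right hx ht).const_mul _
  · exact (key hy _ (by fun_prop) fun t ht => mem_rectBoundary_left hx ht).const_mul _

/-- A lower bound for the factors of an entire product, in summable form. -/
theorem exists_exp_neg_le_of_factor_bounds {γ ω r₀ m : ℝ} (hγ : 0 < γ) (hγ1 : γ ≤ 1)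
    (hγω : γ < ω) (hr₀ : 0 < r₀) (hm : 0 < m) :
    ∃ D : ℝ, ∀ r q f : ℝ, r₀ ≤ r → 0 ≤ q → (q * r ≤ 1 / 2 → 1 - q * r ≤ f) →
      (1 / 2 < q * r → m / r ^ 2 ≤ f) → Real.exp (-(D * r ^ ω * q ^ γ)) ≤ f := by
  set τ := ω - γ with hτ
  have hτ0 : 0 < τ := sub_pos.2 hγω
  set B := 2 / τ + |Real.log m| * r₀ ^ (-τ) with hB
  have hB0 : 0 ≤ B := by positivity
  refine ⟨max (2 * r₀ ^ (-τ)) (2 * B), fun r q f hr hq h1 h2 => ?_⟩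
  have hr0 : 0 < r := hr₀.trans_le hr
  have hsplit : r ^ ω = r ^ τ * r ^ γ := by rw [← Real.rpow_add hr0]; congr 1; ring
  have hone : 1 ≤ r₀ ^ (-τ) * r ^ τ := by
    rw [Real.rpow_neg hr₀.le, inv_mul_eq_div, one_le_div (by positivity)]
    exact Real.rpow_le_rpow hr₀.le hr hτ0.le
  have hqr : (q * r) ^ γ = q ^ γ * r ^ γ := Real.mul_rpow hq hr0.le
  have hu0 : 0 ≤ q * r := by positivity
  have hP : 0 ≤ r ^ ω * q ^ γ := by positivity
  rcases le_or_gt (q * r) (1 / 2) with h | h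
  · refine le_trans ?_ (h1 h)
    have e1 : q * r ≤ (q * r) ^ γ := by
      simpa using Real.rpow_le_rpow_of_exponent_ge' hu0 (by linarith) hγ.le hγ1
    have e2 : 2 * (q * r) ≤ max (2 * r₀ ^ (-τ)) (2 * B) * r ^ ω * q ^ γ := by
      have e3 : 2 * (q * r) ≤ 2 * r₀ ^ (-τ) * (r ^ ω * q ^ γ) := by
        rw [hsplit]
        have : 0 ≤ (q * r) ^ γ := by positivity
        calc 2 * (q * r) ≤ 2 * (1 * (q * r) ^ γ) := by linarith
          _ ≤ 2 * ((r₀ ^ (-τ) * r ^ τ) * (q * r) ^ γ) := by gcongr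
          _ = _ := by rw [hqr]; ring
      rw [mul_assoc]
      exact e3.trans (mul_le_mul_of_nonneg_right (le_max_left _ _) hP)
    calc Real.exp (-(max (2 * r₀ ^ (-τ)) (2 * B) * r ^ ω * q ^ γ))
        ≤ Real.exp (-(2 * (q * r))) := Real.exp_le_exp.2 (by linarith)
      _ ≤ (1 + 2 * (q * r))⁻¹ := by
          rw [Real.exp_neg]
          exact inv_anti₀ (by positivity) (by linarith [Real.add_one_le_exp (2 * (q * r))])
      _ ≤ 1 - q * r := by
          rw [inv_le_iff_one_le_mul₀ (by positivity)]
          nlinarith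
  · refine le_trans ?_ (h2 h)
    have hmr : 0 < m / r ^ 2 := by positivity
    rw [← Real.exp_log hmr]
    refine Real.exp_le_exp.2 ?_
    rw [Real.log_div hm.ne' (by positivity), Real.log_pow]
    have l1 : Real.log r ≤ r ^ τ / τ := Real.log_le_rpow_div hr0.le hτ0
    have l2 : -Real.log m ≤ |Real.log m| * (r₀ ^ (-τ) * r ^ τ) :=
      (neg_le_abs _).trans (le_mul_of_one_le_right (abs_nonneg _) hone)
    have l3 : -(Real.log m - 2 * Real.log r) ≤ B * r ^ τ := by
      have : B * r ^ τ = 2 * (r ^ τ / τ) + |Real.log m| * (r₀ ^ (-τ) * r ^ τ) := by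
        rw [hB]; ring
      linarith
    have l4 : 1 ≤ 2 * (q * r) ^ γ := by
      have : (1 / 2 : ℝ) ≤ (q * r) ^ γ := by
        refine le_trans ?_ (Real.rpow_le_rpow (by norm_num) h.le hγ.le)
        simpa using Real.rpow_le_rpow_of_exponent_ge (x := (1 / 2 : ℝ)) (by norm_num) (by norm_num) hγ1
      linarith
    have l5 : B * r ^ τ ≤ 2 * B * (r ^ ω * q ^ γ) := by
      calc B * r ^ τ ≤ B * r ^ τ * (2 * (q * r) ^ γ) :=
            le_mul_of_one_le_right (by positivity) l4
        _ = _ := by rw [hqr, hsplit]; ring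
    have l6 := mul_le_mul_of_nonneg_right (le_max_right (2 * r₀ ^ (-τ)) (2 * B)) hP
    rw [mul_assoc]
    push_cast
    linarith

/-- The canonical product of genus zero with zeros `Λ`. -/
def genusZeroProduct (Λ : ℕ → ℂ) (z : ℂ) : ℂ := ∏' k, (1 + -(z / Λ k))

section

variable {Λ : ℕ → ℂ} {γ c₀ : ℝ}

theorem summable_norm_inv_of_rpow (hγ1 : γ ≤ 1) (hc₀ : 0 < c₀)
    (hΛ : ∀ k, c₀ ≤ ‖Λ k‖) (hs : Summable fun k => ‖Λ k‖ ^ (-γ)) :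
    Summable fun k => ‖Λ k‖⁻¹ := by
  refine Summable.of_nonneg_of_le (fun k => by positivity) (fun k => ?_)
    (hs.mul_left (c₀ ^ (γ - 1)))
  have h0 : 0 < ‖Λ k‖ := hc₀.trans_le (hΛ k)
  have : ‖Λ k‖⁻¹ = ‖Λ k‖ ^ (γ - 1) * ‖Λ k‖ ^ (-γ) := by
    rw [← Real.rpow_add h0, ← Real.rpow_neg_one]; congr 1; ring
  rw [this]
  gcongr ?_ * _
  exact Real.rpow_le_rpow_of_nonpos hc₀ (hΛ k) (by linarith)

theorem multipliable_genusZeroProduct (hs : Summable fun k => ‖Λ k‖⁻¹) (z : ℂ) :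
    Multipliable fun k => 1 + -(z / Λ k) := by
  refine multipliable_one_add_of_summable ?_
  simpa [div_eq_mul_inv] using hs.mul_left ‖z‖

theorem differentiable_genusZeroProduct (hs : Summable fun k => ‖Λ k‖⁻¹) :
    Differentiable ℂ (genusZeroProduct Λ) := by
  refine differentiable_tprod_one_add hs (fun k => by fun_prop) fun R => ⟨R, fun k z hz => ?_⟩
  rw [norm_neg, norm_div, div_eq_mul_inv]
  gcongr

theorem genusZeroProduct_eq_zero (hΛ : ∀ k, Λ k ≠ 0) (k : ℕ) :
    genusZeroProduct Λ (Λ k) = 0 :=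
  tprod_of_exists_eq_zero ⟨k, by simp [hΛ k]⟩

theorem exists_norm_genusZeroProduct_le (hγ : 0 < γ) (hγ1 : γ ≤ 1) (hc₀ : 0 < c₀)
    (hΛ : ∀ k, c₀ ≤ ‖Λ k‖) (hs : Summable fun k => ‖Λ k‖ ^ (-γ)) :
    ∃ c : ℝ, 0 ≤ c ∧ ∀ z, ‖genusZeroProduct Λ z‖ ≤ Real.exp (c * ‖z‖ ^ γ) := by
  refine ⟨(∑' k, ‖Λ k‖ ^ (-γ)) / γ, div_nonneg (tsum_nonneg fun k => by positivity) hγ.le,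
    fun z => ?_⟩
  have hs' := hs.mul_left (‖z‖ ^ γ / γ)
  refine (norm_tprod_le_exp (multipliable_genusZeroProduct
    (summable_norm_inv_of_rpow hγ1 hc₀ hΛ hs) z) hs' fun k => ?_).trans (le_of_eq ?_)
  · refine (norm_add_le _ _).trans ?_
    rw [norm_neg, norm_div, norm_one]
    refine (one_add_le_exp_rpow (by positivity) hγ hγ1).trans (le_of_eq ?_)
    rw [Real.div_rpow (norm_nonneg _) (norm_nonneg _), Real.rpow_neg (norm_nonneg _)]
    congr 1; ring
  · rw [tsum_mul_left]; congr 1; ring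

/-- Lower bound for the canonical product away from its zeros. -/
theorem exists_le_norm_genusZeroProduct {ω r₀ κ : ℝ} (hγ : 0 < γ) (hγ1 : γ ≤ 1) (hγω : γ < ω)
    (hr₀ : 0 < r₀) (hκ : 0 < κ) (hc₀ : 0 < c₀)
    (hΛ : ∀ k, c₀ ≤ ‖Λ k‖) (hs : Summable fun k => ‖Λ k‖ ^ (-γ)) :
    ∃ D : ℝ, ∀ w, r₀ ≤ ‖w‖ → (∀ k, κ * ‖Λ k‖⁻¹ ≤ ‖w - Λ k‖) →
      Real.exp (-(D * ‖w‖ ^ ω)) ≤ ‖genusZeroProduct Λ w‖ := by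
  obtain ⟨D, hD⟩ := exists_exp_neg_le_of_factor_bounds hγ hγ1 hγω hr₀
    (by positivity : 0 < κ / 4)
  refine ⟨D * ∑' k, ‖Λ k‖ ^ (-γ), fun w hw hsep => ?_⟩
  have hs' := hs.mul_left (-(D * ‖w‖ ^ ω))
  refine le_trans (le_of_eq ?_) (exp_le_norm_tprod (multipliable_genusZeroProduct
    (summable_norm_inv_of_rpow hγ1 hc₀ hΛ hs) w) hs' fun k => ?_)
  · rw [tsum_mul_left]; congr 1; ring
  · have h0 : 0 < ‖Λ k‖ := hc₀.trans_le (hΛ k)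
    have hw0 : 0 < ‖w‖ := hr₀.trans_le hw
    have h := hD ‖w‖ ‖Λ k‖⁻¹ ‖1 + -(w / Λ k)‖ hw (by positivity) (fun _ => ?_) (fun h => ?_)
    · rw [Real.inv_rpow h0.le, ← Real.rpow_neg h0.le] at h
      rwa [neg_mul]
    · have := norm_sub_norm_le (1 : ℂ) (w / Λ k)
      rw [norm_one, norm_div, sub_eq_add_neg (1 : ℂ)] at this
      rwa [inv_mul_eq_div]
    · have hne : Λ k ≠ 0 := norm_pos_iff.1 h0
      have e1 : 1 + -(w / Λ k) = -((w - Λ k) / Λ k) := by field_simp; ring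
      rw [e1, norm_neg, norm_div, le_div_iff₀ h0]
      refine le_trans ?_ (hsep k)
      rw [inv_mul_eq_div, lt_div_iff₀ h0] at h
      have e2 : κ / 4 / ‖w‖ ^ 2 * ‖Λ k‖ = κ * (‖Λ k‖ * ‖Λ k‖) / (4 * ‖w‖ ^ 2 * ‖Λ k‖) := by
        field_simp
      rw [e2, ← div_eq_mul_inv, div_le_div_iff₀ (by positivity) h0]
      have : ‖Λ k‖ * ‖Λ k‖ ≤ 4 * ‖w‖ ^ 2 := by nlinarith
      calc _ ≤ κ * (4 * ‖w‖ ^ 2) * ‖Λ k‖ := by gcongr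
        _ = _ := by ring

end

/-- The entire function `(exp v - 1) / v`. -/
def expQuot : ℂ → ℂ := dslope Complex.exp 0

theorem expQuot_of_ne {v : ℂ} (hv : v ≠ 0) : expQuot v = (Complex.exp v - 1) / v := by
  rw [expQuot, dslope_of_ne _ hv, slope_def_field]; simp

theorem expQuot_zero : expQuot 0 = 1 := by simp [expQuot]

theorem differentiable_expQuot : Differentiable ℂ expQuot := by
  rw [← differentiableOn_univ, expQuot, Complex.differentiableOn_dslope Filter.univ_mem]
  exact Complex.differentiable_exp.differentiableOn

theorem norm_expQuot_le (v : ℂ) : ‖expQuot v‖ ≤ Real.exp ‖v‖ := by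
  rcases eq_or_ne v 0 with rfl | hv
  · simp [expQuot_zero]
  · rw [expQuot_of_ne hv, norm_div, div_le_iff₀ (norm_pos_iff.2 hv)]
    simpa [mul_comm] using Complex.norm_exp_sub_sum_le_norm_mul_exp v 1

theorem norm_expQuot_sub_one_mul (v : ℂ) :
    ‖expQuot v - 1‖ * ‖v‖ = ‖Complex.exp v - 1 - v‖ := by
  rcases eq_or_ne v 0 with rfl | hv
  · simp [expQuot_zero]
  · rw [expQuot_of_ne hv, ← norm_mul]; congr 1; field_simp

theorem norm_expQuot_sub_one_le (v : ℂ) : ‖expQuot v - 1‖ ≤ ‖v‖ * Real.exp ‖v‖ := by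
  rcases eq_or_ne v 0 with rfl | hv
  · simp [expQuot_zero]
  · refine le_of_mul_le_mul_right ?_ (norm_pos_iff.2 hv)
    rw [norm_expQuot_sub_one_mul]
    have := Complex.norm_exp_sub_sum_le_norm_mul_exp v 2
    simp only [Finset.sum_range_succ, Finset.sum_range_zero] at this
    calc _ = _ := by congr 1; simp; ring
      _ ≤ _ := this
      _ = _ := by ring

theorem norm_expQuot_sub_one_le_norm {v : ℂ} (h : ‖v‖ ≤ 1) : ‖expQuot v - 1‖ ≤ ‖v‖ := by
  rcases eq_or_ne v 0 with rfl | hv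
  · simp [expQuot_zero]
  · refine le_of_mul_le_mul_right ?_ (norm_pos_iff.2 hv)
    rw [norm_expQuot_sub_one_mul, ← sq]
    exact Complex.norm_exp_sub_one_sub_id_le h

theorem norm_expQuot_I_mul_le_one (t : ℝ) : ‖expQuot (Complex.I * t)‖ ≤ 1 := by
  rcases eq_or_ne t 0 with rfl | ht
  · simp [expQuot_zero]
  · have h : Complex.I * (t : ℂ) ≠ 0 := by simp [ht]
    rw [expQuot_of_ne h, norm_div, div_le_one (norm_pos_iff.2 h)]
    simpa using Real.norm_exp_I_mul_ofReal_sub_one_le (x := t)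

theorem norm_expQuot_I_mul_le (t : ℝ) (ht : t ≠ 0) : ‖expQuot (Complex.I * t)‖ ≤ 2 / |t| := by
  have h : Complex.I * (t : ℂ) ≠ 0 := by simp [ht]
  rw [expQuot_of_ne h, norm_div]
  have e : ‖Complex.I * (t : ℂ)‖ = |t| := by simp
  rw [e]
  gcongr
  refine (norm_sub_le _ _).trans ?_
  rw [Complex.norm_exp]; simp; norm_num

/-- The product of the functions `(exp (i a_k z) - 1) / (i a_k z)`. -/
def expQuotProduct (a : ℕ → ℝ) (z : ℂ) : ℂ :=
  ∏' k, (1 + (expQuot (Complex.I * a k * z) - 1))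

section

variable {a : ℕ → ℝ}

theorem norm_I_mul_ofReal_mul (ha : ∀ k, 0 < a k) (k : ℕ) (z : ℂ) :
    ‖Complex.I * a k * z‖ = a k * ‖z‖ := by
  simp [abs_of_pos (ha k)]

theorem norm_expQuot_factor_le (ha : ∀ k, 0 < a k) (hs : Summable a) (k : ℕ) {R : ℝ} {z : ℂ}
    (hz : ‖z‖ ≤ R) :
    ‖expQuot (Complex.I * a k * z) - 1‖ ≤ (R * Real.exp ((∑' j, a j) * R)) * a k := by
  refine (norm_expQuot_sub_one_le _).trans ?_
  rw [norm_I_mul_ofReal_mul ha]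
  have hR : 0 ≤ R := (norm_nonneg _).trans hz
  have h1 : a k * ‖z‖ ≤ (∑' j, a j) * R := by
    have := hs.le_tsum k fun j _ => (ha j).le
    have : 0 ≤ ∑' j, a j := tsum_nonneg fun j => (ha j).le
    have := ha k
    gcongr
  have h2 : a k * ‖z‖ ≤ a k * R := by have := ha k; gcongr
  calc a k * ‖z‖ * Real.exp (a k * ‖z‖) ≤ a k * R * Real.exp ((∑' j, a j) * R) := by
        have := ha k; gcongr
    _ = _ := by ring

theorem multipliable_expQuotProduct (ha : ∀ k, 0 < a k) (hs : Summable a) (z : ℂ) :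
    Multipliable fun k => 1 + (expQuot (Complex.I * a k * z) - 1) := by
  refine multipliable_one_add_of_summable ?_
  exact Summable.of_nonneg_of_le (fun _ => norm_nonneg _)
    (fun k => norm_expQuot_factor_le ha hs k le_rfl) (hs.mul_left _)

theorem differentiable_expQuotProduct (ha : ∀ k, 0 < a k) (hs : Summable a) :
    Differentiable ℂ (expQuotProduct a) := by
  refine differentiable_tprod_one_add hs (fun k => ?_) fun R =>
    ⟨_, fun k z hz => norm_expQuot_factor_le ha hs k hz⟩
  exact (differentiable_expQuot.comp (differentiable_id.const_mul _)).sub_const _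

theorem norm_expQuotProduct_le (ha : ∀ k, 0 < a k) (hs : Summable a) (z : ℂ) :
    ‖expQuotProduct a z‖ ≤ Real.exp ((∑' k, a k) * ‖z‖) := by
  rw [← tsum_mul_right]
  refine norm_tprod_le_exp (multipliable_expQuotProduct ha hs z) (hs.mul_right _) fun k => ?_
  rw [add_sub_cancel, ← norm_I_mul_ofReal_mul ha]
  exact norm_expQuot_le _

/-- In a lower half plane the product is at least the exponential of a small power. -/
theorem exists_le_norm_expQuotProduct {γ ω y₀ : ℝ} (ha : ∀ k, 0 < a k) (hs : Summable a)
    (hγ : 0 < γ) (hγ1 : γ ≤ 1) (hγω : γ < ω) (hy : 0 < y₀) (hsγ : Summable fun k => a k ^ γ) :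
    ∃ D : ℝ, ∀ w : ℂ, w.im ≤ -y₀ → Real.exp (-(D * ‖w‖ ^ ω)) ≤ ‖expQuotProduct a w‖ := by
  obtain ⟨D, hD⟩ := exists_exp_neg_le_of_factor_bounds hγ hγ1 hγω hy (by positivity : 0 < y₀ ^ 2)
  refine ⟨D * ∑' k, a k ^ γ, fun w hw => ?_⟩
  have hyw : y₀ ≤ ‖w‖ := by
    have := Complex.abs_im_le_norm w
    rw [abs_of_nonpos (by linarith)] at this
    linarith
  have hs' := hsγ.mul_left (-(D * ‖w‖ ^ ω))
  refine le_trans (le_of_eq ?_) (exp_le_norm_tprod (multipliable_expQuotProduct ha hs w) hs'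
    fun k => ?_)
  · rw [tsum_mul_left]; congr 1; ring
  · rw [add_sub_cancel, neg_mul]
    have e := norm_I_mul_ofReal_mul ha k w
    have hak := ha k
    have hw0 : 0 < ‖w‖ := hy.trans_le hyw
    refine hD _ _ _ hyw hak.le (fun h => ?_) (fun h => ?_)
    · have h1 := norm_expQuot_sub_one_le_norm (v := Complex.I * a k * w) (by linarith)
      have h2 := norm_sub_norm_le (1 : ℂ) (1 - expQuot (Complex.I * a k * w))
      rw [norm_one, norm_sub_rev, sub_sub_cancel] at h2
      linarith
    · have hne : Complex.I * a k * w ≠ 0 := by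
        rw [← norm_pos_iff, e]; positivity
      have h1 : a k * y₀ ≤ ‖Complex.exp (Complex.I * a k * w) - 1‖ := by
        have h2 := norm_sub_norm_le (Complex.exp (Complex.I * a k * w)) 1
        rw [norm_one, Complex.norm_exp] at h2
        have h3 : (Complex.I * a k * w).re = a k * -w.im := by simp
        rw [h3] at h2
        have h4 := Real.add_one_le_exp (a k * -w.im)
        have h5 : a k * y₀ ≤ a k * -w.im := by gcongr; linarith
        linarith
      rw [expQuot_of_ne hne, norm_div, e]
      calc y₀ ^ 2 / ‖w‖ ^ 2 = (y₀ / ‖w‖) * (y₀ / ‖w‖) := by ring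
        _ ≤ y₀ / ‖w‖ * 1 := by gcongr; exact (div_le_one hw0).2 hyw
        _ = a k * y₀ / (a k * ‖w‖) := by field_simp
        _ ≤ _ := by gcongr

end

/-- For `a_k` a power of `k`, the product decays on the real line like the exponential of a
power. -/
theorem norm_expQuotProduct_ofReal_le {ν A : ℝ} (hν : 0 < ν) (hA : 0 < A)
    (hs : Summable fun k : ℕ => A * ((k : ℝ) + 1) ^ (-ν⁻¹)) (x : ℝ) :
    ‖expQuotProduct (fun k : ℕ => A * ((k : ℝ) + 1) ^ (-ν⁻¹)) x‖ ≤
      Real.exp (1 - (A / (2 * Real.exp 1)) ^ ν * |x| ^ ν) := by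
  set a : ℕ → ℝ := fun k : ℕ => A * ((k : ℝ) + 1) ^ (-ν⁻¹) with ha_def
  have ha : ∀ k, 0 < a k := fun k => by positivity
  set t := A / (2 * Real.exp 1) * |x| with ht
  have ht0 : 0 ≤ t := by positivity
  set N := ⌊t ^ ν⌋₊ with hN
  have hfac : ∀ k, ‖1 + (expQuot (Complex.I * a k * x) - 1)‖ ≤
      Real.exp (if k ∈ Finset.range N then -1 else 0) := fun k => by
    have e : Complex.I * (a k : ℂ) * (x : ℂ) = Complex.I * ((a k * x : ℝ) : ℂ) := by
      push_cast; ring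
    rw [add_sub_cancel, e]
    split_ifs with hk
    · have h1 : (k : ℝ) + 1 ≤ t ^ ν := by
        have : k + 1 ≤ N := Finset.mem_range.1 hk
        have h2 : (N : ℝ) ≤ t ^ ν := Nat.floor_le (by positivity)
        exact le_trans (by exact_mod_cast this) h2
      have h2 : ((k : ℝ) + 1) ^ ν⁻¹ ≤ t := by
        have := Real.rpow_le_rpow (by positivity) h1 (inv_nonneg.2 hν.le)
        rwa [Real.rpow_rpow_inv ht0 hν.ne'] at this
      have hk0 : (0 : ℝ) < ((k : ℝ) + 1) ^ ν⁻¹ := by positivity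
      have hx : 0 < |x| := by
        rcases (abs_nonneg x).eq_or_lt with h | h
        · rw [ht, ← h, mul_zero] at h2; linarith
        · exact h
      have hax : 2 * Real.exp 1 ≤ |a k * x| := by
        rw [abs_mul, abs_of_pos (ha k), ha_def]
        simp only
        rw [Real.rpow_neg (by positivity)]
        rw [ht, div_mul_eq_mul_div, le_div_iff₀ (by positivity)] at h2
        rw [← div_eq_mul_inv, div_mul_eq_mul_div, le_div_iff₀ hk0]
        linarith
      have hax0 : 0 < |a k * x| := lt_of_lt_of_le (by positivity) hax
      refine (norm_expQuot_I_mul_le _ (abs_pos.1 hax0)).trans ?_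
      rw [Real.exp_neg, div_le_iff₀ hax0, inv_mul_eq_div, le_div_iff₀ (Real.exp_pos _)]
      exact hax
    · simpa using norm_expQuot_I_mul_le_one (a k * x)
  have hsum : Summable fun k => if k ∈ Finset.range N then (-1 : ℝ) else 0 :=
    summable_of_ne_finset_zero (s := Finset.range N) fun k hk => by simp [hk]
  refine (norm_tprod_le_exp (multipliable_expQuotProduct ha hs x) hsum hfac).trans ?_
  rw [tsum_eq_sum (s := Finset.range N) (fun k hk => by simp [hk])]
  rw [Real.exp_le_exp, ← Real.mul_rpow (by positivity) (abs_nonneg _), ← ht]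
  rw [Finset.sum_congr rfl fun k hk => by rw [if_pos hk]]
  have := Nat.lt_floor_add_one (t ^ ν)
  simp only [Finset.sum_const, Finset.card_range, nsmul_eq_mul]
  linarith

theorem dslope_comm {F : ℂ → ℂ} (z w : ℂ) : dslope F w z = dslope F z w := by
  rcases eq_or_ne z w with rfl | h
  · rfl
  · rw [dslope_of_ne _ h, dslope_of_ne _ h.symm, slope_comm]

theorem differentiable_dslope {F : ℂ → ℂ} (hF : Differentiable ℂ F) (w : ℂ) :
    Differentiable ℂ (dslope F w) := by
  rw [← differentiableOn_univ, Complex.differentiableOn_dslope univ_mem]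
  exact hF.differentiableOn

theorem norm_dslope_le {F : ℂ → ℂ} (hF : Differentiable ℂ F) {c γ : ℝ} (hc : 0 ≤ c) (hγ : 0 ≤ γ)
    (hb : ∀ z, ‖F z‖ ≤ Real.exp (c * ‖z‖ ^ γ)) (w z : ℂ) :
    ‖dslope F w z‖ ≤ 2 * Real.exp (c * (1 + ‖w‖) ^ γ) * Real.exp (c * ‖z‖ ^ γ) := by
  have hslope : ∀ u, 1 ≤ ‖u - w‖ → ‖dslope F w u‖ ≤ ‖F u‖ + ‖F w‖ := fun u hu => by
    have hne : u ≠ w := fun h => by simp [h] at hu; linarith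
    rw [dslope_of_ne _ hne, slope_def_field, norm_div]
    exact (div_le_self (norm_nonneg _) hu).trans (norm_sub_le _ _)
  have hw : ‖F w‖ ≤ Real.exp (c * (1 + ‖w‖) ^ γ) := (hb w).trans (by gcongr; linarith)
  have h1 : 1 ≤ Real.exp (c * ‖z‖ ^ γ) := Real.one_le_exp (by positivity)
  have h2 : 1 ≤ Real.exp (c * (1 + ‖w‖) ^ γ) := Real.one_le_exp (by positivity)
  rcases le_total 1 ‖z - w‖ with h | h
  · refine (hslope z h).trans ?_
    have := hb z
    nlinarith
  · have : ‖dslope F w z‖ ≤ 2 * Real.exp (c * (1 + ‖w‖) ^ γ) := by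
      refine Complex.norm_le_of_forall_mem_frontier_norm_le (U := Metric.ball w 1)
        Metric.isBounded_ball (differentiable_dslope hF w).diffContOnCl (fun u hu => ?_) ?_
      · rw [frontier_ball _ one_ne_zero, mem_sphere_iff_norm] at hu
        have h3 : ‖u‖ ≤ 1 + ‖w‖ := by
          have := norm_sub_norm_le u w
          linarith
        have h4 : ‖F u‖ ≤ Real.exp (c * (1 + ‖w‖) ^ γ) := (hb u).trans (by gcongr)
        linarith [hslope u hu.ge]
      · rw [closure_ball _ one_ne_zero]; simpa [dist_eq_norm] using h
    exact this.trans (le_mul_of_one_le_right (by positivity) h1)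

/-- In an interval there is a point at prescribed distances from a sequence, provided the
distances have a small sum. -/
theorem exists_mem_Ioo_forall_le_abs_sub {p q : ℝ} {t d : ℕ → ℝ} (hd : ∀ k, 0 ≤ d k)
    (hs : Summable d) (hlt : 2 * ∑' k, d k < q - p) :
    ∃ x ∈ Set.Ioo p q, ∀ k, d k ≤ |x - t k| := by
  by_contra! hcon
  have hsub : Set.Ioo p q ⊆ ⋃ k, Set.Ioo (t k - d k) (t k + d k) := fun x hx => by
    obtain ⟨k, hk⟩ := hcon x hx
    rw [abs_lt] at hk
    exact Set.mem_iUnion.2 ⟨k, by linarith, by linarith⟩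
  have h1 := (measure_mono hsub).trans (measure_iUnion_le (μ := volume) _)
  simp only [Real.volume_Ioo] at h1
  have e : ∀ k, t k + d k - (t k - d k) = 2 * d k := fun k => by ring
  simp only [e] at h1
  rw [← ENNReal.ofReal_tsum_of_nonneg (fun k => mul_nonneg zero_le_two (hd k)) (hs.mul_left 2),
    tsum_mul_left, ENNReal.ofReal_le_ofReal_iff
      (mul_nonneg zero_le_two (tsum_nonneg hd))] at h1
  linarith

/-- A partition of the line into short intervals whose end points keep prescribed distances from a
sequence. -/
theorem exists_partition {ε : ℝ} (hε : 0 < ε) {t d : ℕ → ℝ} (hd : ∀ k, 0 < d k)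
    (hs : Summable d) (hlt : 2 * ∑' k, d k < ε) :
    ∃ x : ℤ → ℝ, StrictMono x ∧ (∀ m, x (m + 1) - x m ≤ 2 * ε) ∧ (∀ m k, d k ≤ |x m - t k|) ∧
      ∃ p : ℕ → ℤ, ∀ k, x (p k) < t k ∧ t k < x (p k + 1) := by
  have h : ∀ m : ℤ, ∃ x ∈ Set.Ioo (ε * m) (ε * (m + 1)), ∀ k, d k ≤ |x - t k| := fun m =>
    exists_mem_Ioo_forall_le_abs_sub (fun k => (hd k).le) hs (by linarith)
  choose x hx hdist using h
  refine ⟨x, strictMono_int_of_lt_succ fun m => ?_, fun m => ?_, hdist, ?_⟩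
  · have h1 := (hx m).2
    have h2 := (hx (m + 1)).1
    push_cast at h2
    exact h1.trans h2
  · have h1 := (hx m).1
    have h2 := (hx (m + 1)).2
    push_cast at h2
    linarith
  · have h2 : ∀ k, ∃ m, x m < t k ∧ t k < x (m + 1) := fun k => by
      have hl := Int.floor_le (t k / ε)
      have hu := Int.lt_floor_add_one (t k / ε)
      set m := ⌊t k / ε⌋
      rw [le_div_iff₀ hε] at hl
      rw [div_lt_iff₀ hε] at hu
      have hne : x m ≠ t k := fun h => by
        have := hdist m k
        rw [h, sub_self, abs_zero] at this
        linarith [hd k]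
      rcases hne.lt_or_gt with h | h
      · refine ⟨m, h, ?_⟩
        have := (hx (m + 1)).1
        push_cast at this
        linarith
      · refine ⟨m - 1, ?_, by simpa using h⟩
        have := (hx (m - 1)).2
        push_cast at this
        linarith
    choose p hp using h2
    exact ⟨p, hp⟩

theorem StrictMono.eq_of_mem_Icc_of_mem_Ioo {x : ℤ → ℝ} (hx : StrictMono x) {m n : ℤ} {t : ℝ}
    (h1 : t ∈ Set.Icc (x m) (x (m + 1))) (h2 : x n < t ∧ t < x (n + 1)) : m = n := by
  have h3 := hx.lt_iff_lt.1 (h1.1.trans_lt h2.2)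
  have h4 := hx.lt_iff_lt.1 (h2.1.trans_le h1.2)
  omega

/-- Interpolation by contour integrals over the cells of a grid. -/
theorem exists_interpolating_entire {Λ : ℕ → ℂ} {F h : ℂ → ℂ} {U : Set ℂ} {x y : ℤ → ℝ}
    {p q : ℕ → ℤ} {E : ℕ → ℝ} {c γ L : ℝ} (hc : 0 ≤ c) (hγ : 0 ≤ γ)
    (hx : StrictMono x) (hy : StrictMono y)
    (hxL : ∀ m, x (m + 1) - x m ≤ L) (hyL : ∀ m, y (m + 1) - y m ≤ L)
    (hp : ∀ k, x (p k) < (Λ k).re ∧ (Λ k).re < x (p k + 1))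
    (hq : ∀ k, y (q k) < (Λ k).im ∧ (Λ k).im < y (q k + 1))
    (hF : Differentiable ℂ F) (hFΛ : ∀ k, F (Λ k) = 0)
    (hF0 : ∀ k, ∀ w ∈ rectBoundary (x (p k)) (x (p k + 1)) (y (q k)) (y (q k + 1)), F w ≠ 0)
    (hU : IsOpen U) (hh : DifferentiableOn ℂ h U)
    (hsub : ∀ k, Set.Icc (x (p k)) (x (p k + 1)) ×ℂ Set.Icc (y (q k)) (y (q k + 1)) ⊆ U)
    (hE : Summable E) (hE0 : ∀ k, 0 ≤ E k)
    (hb : ∀ k, ∀ w ∈ rectBoundary (x (p k)) (x (p k + 1)) (y (q k)) (y (q k + 1)), ∀ z,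
      ‖h w / F w * dslope F w z‖ ≤ E k * Real.exp (c * ‖z‖ ^ γ)) :
    ∃ H : ℂ → ℂ, Differentiable ℂ H ∧ (∀ k, H (Λ k) = h (Λ k)) ∧
      ∃ B : ℝ, 0 ≤ B ∧ ∀ z, ‖H z‖ ≤ B * Real.exp (c * ‖z‖ ^ γ) := by
  set idx : ℕ → ℤ × ℤ := fun k => (p k, q k) with hidx
  set r : Set.range idx → ℕ := Set.rangeSplitting idx with hr
  have hri : Function.Injective r := Set.rangeSplitting_injective idx
  have hxle : ∀ m, x m ≤ x (m + 1) := fun m => (hx (lt_add_one m)).le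
  have hyle : ∀ m, y m ≤ y (m + 1) := fun m => (hy (lt_add_one m)).le
  have hL : 0 ≤ L := (sub_nonneg.2 (hxle 0)).trans (hxL 0)
  set T : ℕ → ℂ → ℂ := fun k z => rectIntegral (fun w => h w / F w * dslope F w z)
    (x (p k)) (x (p k + 1)) (y (q k)) (y (q k + 1)) with hT
  have hTd : ∀ k, Differentiable ℂ (T k) := fun k => by
    refine differentiable_rectIntegral_param (f := fun z w => h w / F w * dslope F w z)
      (hxle _) (hyle _) (fun z => ?_) (fun w hw => ?_) (fun R => ?_)
    · have h1 : ContinuousOn h (rectBoundary (x (p k)) (x (p k + 1)) (y (q k)) (y (q k + 1))) :=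
        hh.continuousOn.mono fun w hw => hsub k hw.1
      simp only [dslope_comm z]
      exact (h1.div hF.continuous.continuousOn (hF0 k)).mul
        (differentiable_dslope hF z).continuous.continuousOn
    · exact (differentiable_dslope hF w).const_mul _
    · refine ⟨E k * Real.exp (c * R ^ γ), fun z hz w hw => (hb k w hw z).trans ?_⟩
      have := hE0 k
      gcongr
  have hTb : ∀ k z, ‖T k z‖ ≤ E k * (4 * L) * Real.exp (c * ‖z‖ ^ γ) := fun k z => by
    refine (norm_rectIntegral_le (hxle _) (hyle _) fun w hw => hb k w hw z).trans ?_
    have h1 : 2 * (x (p k + 1) - x (p k) + (y (q k + 1) - y (q k))) ≤ 4 * L := by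
      linarith [hxL (p k), hyL (q k)]
    have := hE0 k
    calc _ ≤ E k * Real.exp (c * ‖z‖ ^ γ) * (4 * L) := by gcongr
      _ = _ := by ring
  have hEr : Summable fun s => E (r s) * (4 * L) := (hE.comp_injective hri).mul_right _
  have hTval : ∀ k j, T k (Λ j) =
      if idx k = idx j then 2 * Real.pi * Complex.I * h (Λ j) else 0 := fun k j => by
    have e : T k (Λ j) = rectIntegral (fun w => h w / (w - Λ j))
        (x (p k)) (x (p k + 1)) (y (q k)) (y (q k + 1)) := by
      refine rectIntegral_congr (hxle _) (hyle _) fun w hw => ?_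
      have h0 := hF0 k w hw
      have hne : Λ j ≠ w := fun h => h0 (h ▸ hFΛ j)
      have hne' : w - Λ j ≠ 0 := sub_ne_zero.2 hne.symm
      have h_sub : Λ j - w ≠ 0 := sub_ne_zero.2 hne
      rw [dslope_of_ne _ hne, slope_def_field, hFΛ]
      field_simp
      ring
    rw [e]
    split_ifs with hkj
    · have h1 : p k = p j := congrArg Prod.fst hkj
      have h2 : q k = q j := congrArg Prod.snd hkj
      exact rectIntegral_div_sub ⟨by rw [h1]; exact hp j, by rw [h2]; exact hq j⟩ hU (hsub k) hh
    · refine rectIntegral_eq_zero (hxle _) (hyle _) ?_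
      refine (hh.mono (hsub k)).div (by fun_prop) fun w hw h0 => hkj ?_
      rw [sub_eq_zero] at h0
      rw [h0] at hw
      exact Prod.ext (hx.eq_of_mem_Icc_of_mem_Ioo hw.1 (hp j))
        (hy.eq_of_mem_Icc_of_mem_Ioo hw.2 (hq j))
  refine ⟨fun z => (2 * Real.pi * Complex.I)⁻¹ * ∑' s, T (r s) z, ?_, fun j => ?_, ?_⟩
  · refine Differentiable.const_mul (fun z => ?_) _
    refine (Complex.differentiableOn_tsum_of_summable_norm
      (U := Metric.ball 0 (‖z‖ + 1)) (u := fun s => E (r s) * (4 * L) *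
        Real.exp (c * (‖z‖ + 1) ^ γ)) (hEr.mul_right _)
      (fun s => (hTd (r s)).differentiableOn) Metric.isOpen_ball fun s w hw => ?_).differentiableAt
      (Metric.isOpen_ball.mem_nhds (by simp))
    refine (hTb _ _).trans ?_
    have := hE0 (r s)
    have := mem_ball_zero_iff.1 hw
    gcongr
  · have hz : ∑' s, T (r s) (Λ j) = 2 * Real.pi * Complex.I * h (Λ j) := by
      have hrj : ∀ s : Set.range idx, idx (r s) = s := Set.apply_rangeSplitting idx
      rw [tsum_eq_single (⟨idx j, j, rfl⟩ : Set.range idx) fun s hs => ?_]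
      · rw [hTval, hrj, if_pos rfl]
      · rw [hTval, hrj, if_neg fun h => hs (Subtype.ext h)]
    simp only
    rw [hz, inv_mul_cancel_left₀ Complex.two_pi_I_ne_zero]
  · refine ⟨‖(2 * Real.pi * Complex.I)⁻¹‖ * ∑' s, E (r s) * (4 * L), mul_nonneg (norm_nonneg _)
      (tsum_nonneg fun s => mul_nonneg (hE0 _) (by positivity)), fun z => ?_⟩
    rw [norm_mul, mul_assoc ‖_‖, ← tsum_mul_right]
    gcongr
    exact tsum_of_norm_bounded (hEr.mul_right _).hasSum fun s => hTb _ _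

theorem exists_exp_rpow_sub_le {ω β γ A b : ℝ} (hγ : 0 < γ) (hγω : γ ≤ ω) (hωβ : ω < β)
    (hA : 0 ≤ A) (hb : 0 < b) :
    ∃ M : ℝ, 0 ≤ M ∧ ∀ t : ℝ, 0 < t →
      Real.exp (A * (1 + t) ^ ω - b * t ^ β) ≤ M * t ^ (-γ) := by
  obtain ⟨M, hM⟩ := exists_mul_one_add_rpow_le (hγ.trans_le hγω) hωβ (by positivity : 0 ≤ A + 1) hb
  refine ⟨Real.exp M, (Real.exp_pos _).le, fun t ht => ?_⟩
  rw [Real.rpow_neg ht.le, ← div_eq_mul_inv, le_div_iff₀ (by positivity)]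
  have h1 : t ^ γ ≤ Real.exp ((1 + t) ^ ω) := by
    have h2 : t ^ γ ≤ (1 + t) ^ γ := by gcongr; linarith
    have h3 : (1 + t) ^ γ ≤ (1 + t) ^ ω := by gcongr; linarith
    linarith [Real.add_one_le_exp ((1 + t) ^ ω)]
  calc _ ≤ Real.exp (A * (1 + t) ^ ω - b * t ^ β) * Real.exp ((1 + t) ^ ω) := by gcongr
    _ ≤ Real.exp M := by
      rw [← Real.exp_add, Real.exp_le_exp]
      linarith [hM t ht.le]

theorem exists_pos_le_neg_im {C β : ℝ} {Λ : ℕ → ℂ} (hC : 0 < C) (hβ : 0 < β)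
    (hdom : ∀ k, (Λ k).im < 0 ∧ C * ‖Λ k‖ ^ β ≤ -(Λ k).im)
    (hfin : {k : ℕ | ‖Λ k‖ ≤ 1}.Finite) : ∃ c₀ : ℝ, 0 < c₀ ∧ ∀ k, c₀ ≤ -(Λ k).im := by
  have hlarge : ∀ k, k ∉ {k : ℕ | ‖Λ k‖ ≤ 1} → C ≤ -(Λ k).im := fun k hk => by
    refine le_trans ?_ (hdom k).2
    exact le_mul_of_one_le_right hC.le (Real.one_le_rpow (not_le.1 hk).le hβ.le)
  rcases Set.eq_empty_or_nonempty {k : ℕ | ‖Λ k‖ ≤ 1} with h | h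
  · exact ⟨C, hC, fun k => hlarge k (by simp [h])⟩
  · obtain ⟨j, -, hj⟩ := Set.exists_min_image _ (fun k => -(Λ k).im) hfin h
    refine ⟨min C (-(Λ j).im), lt_min hC (neg_pos.2 (hdom j).1), fun k => ?_⟩
    by_cases hk : k ∈ {k : ℕ | ‖Λ k‖ ≤ 1}
    · exact (min_le_right _ _).trans (hj k hk)
    · exact (min_le_left _ _).trans (hlarge k hk)

theorem norm_exp_neg_I_mul (σ : ℝ) (w : ℂ) :
    ‖Complex.exp (-Complex.I * σ * w)‖ = Real.exp (σ * w.im) := by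
  rw [Complex.norm_exp]; simp

/-- Interpolation of `exp (-i σ z) / S z` on a sparse sequence in a curved domain of the lower half
plane, by an entire function of small order. -/
theorem exists_entire_eq_exp_div {σ C β γ ω c₀ D : ℝ} {Λ : ℕ → ℂ} {S : ℂ → ℂ}
    (hσ : 0 < σ) (hC : 0 < C) (hγ : 0 < γ) (hγ1 : γ ≤ 1) (hγω : γ < ω) (hωβ : ω < β)
    (hc₀ : 0 < c₀) (him : ∀ k, c₀ ≤ -(Λ k).im) (hdom : ∀ k, C * ‖Λ k‖ ^ β ≤ -(Λ k).im)
    (hs : Summable fun k => ‖Λ k‖ ^ (-γ)) (hS : Differentiable ℂ S)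
    (hSD : ∀ w : ℂ, w.im ≤ -(c₀ / 4) → Real.exp (-(D * ‖w‖ ^ ω)) ≤ ‖S w‖) :
    ∃ H : ℂ → ℂ, Differentiable ℂ H ∧
      (∀ k, H (Λ k) = Complex.exp (-Complex.I * σ * Λ k) / S (Λ k)) ∧
      ∃ B c : ℝ, 0 ≤ B ∧ 0 ≤ c ∧ ∀ z, ‖H z‖ ≤ B * Real.exp (c * ‖z‖ ^ γ) := by
  have hω : 0 < ω := hγ.trans hγω
  have hΛ : ∀ k, c₀ ≤ ‖Λ k‖ := fun k =>
    (him k).trans ((neg_le_abs _).trans (Complex.abs_im_le_norm _))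
  have hinv := summable_norm_inv_of_rpow hγ1 hc₀ hΛ hs
  set σ₁ := ∑' k, ‖Λ k‖⁻¹
  have hσ₁ : 0 ≤ σ₁ := tsum_nonneg fun k => by positivity
  set κ := c₀ / (32 * (σ₁ + 1)) with hκ
  have hκ0 : 0 < κ := by positivity
  have hd : ∀ k, 0 < κ * ‖Λ k‖⁻¹ := fun k => mul_pos hκ0 (inv_pos.2 (hc₀.trans_le (hΛ k)))
  have hlt : 2 * ∑' k, κ * ‖Λ k‖⁻¹ < c₀ / 8 := by
    rw [tsum_mul_left, hκ, div_mul_eq_mul_div, mul_div_assoc', div_lt_iff₀ (by positivity)]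
    nlinarith
  obtain ⟨x, hx, hxL, hxd, p, hp⟩ := exists_partition (by positivity : 0 < c₀ / 8)
    (t := fun k => (Λ k).re) hd (hinv.mul_left κ) hlt
  obtain ⟨y, hy, hyL, hyd, q, hq⟩ := exists_partition (by positivity : 0 < c₀ / 8)
    (t := fun k => (Λ k).im) hd (hinv.mul_left κ) hlt
  set F := genusZeroProduct Λ
  have hF : Differentiable ℂ F := differentiable_genusZeroProduct hinv
  obtain ⟨c, hc, hFc⟩ := exists_norm_genusZeroProduct_le hγ hγ1 hc₀ hΛ hs
  obtain ⟨D', hFD⟩ := exists_le_norm_genusZeroProduct (r₀ := c₀ / 2) hγ hγ1 hγω (by positivity)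
    hκ0 hc₀ hΛ hs
  obtain ⟨M, hM0, hM⟩ := exists_exp_rpow_sub_le (A := (c + |D| + |D'|) * 2 ^ ω) (b := σ * C / 2)
    hγ hγω.le hωβ (by positivity) (by positivity)
  have hcell : ∀ k, ∀ w ∈ Set.Icc (x (p k)) (x (p k + 1)) ×ℂ Set.Icc (y (q k)) (y (q k + 1)),
      ‖w‖ ≤ 2 * ‖Λ k‖ ∧ w.im ≤ (Λ k).im / 2 ∧ w.im ≤ -(c₀ / 2) := fun k w hw => by
    obtain ⟨⟨h1, h2⟩, h3, h4⟩ := hw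
    have hre : |(w - Λ k).re| ≤ c₀ / 4 := by
      rw [Complex.sub_re, abs_le]
      constructor <;> linarith [hp k, (hp k).1, (hp k).2, hxL (p k)]
    have him' : |(w - Λ k).im| ≤ c₀ / 4 := by
      rw [Complex.sub_im, abs_le]
      constructor <;> linarith [(hq k).1, (hq k).2, hyL (q k)]
    have h5 := Complex.norm_le_abs_re_add_abs_im (w - Λ k)
    have h6 := norm_sub_norm_le w (Λ k)
    have h7 := hΛ k
    have h8 := him k
    have h9 := (abs_le.1 him').2
    rw [Complex.sub_im] at h9
    exact ⟨by linarith, by linarith, by linarith⟩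
  have hnorm : ∀ w : ℂ, w.im ≤ -(c₀ / 2) → c₀ / 2 ≤ ‖w‖ := fun w hw => by
    linarith [neg_le_abs w.im, Complex.abs_im_le_norm w]
  have hsep : ∀ k, ∀ w ∈ rectBoundary (x (p k)) (x (p k + 1)) (y (q k)) (y (q k + 1)),
      ∀ j, κ * ‖Λ j‖⁻¹ ≤ ‖w - Λ j‖ := fun k w hw j => by
    have hre := Complex.abs_re_le_norm (w - Λ j)
    have him := Complex.abs_im_le_norm (w - Λ j)
    rw [Complex.sub_re] at hre
    rw [Complex.sub_im] at him
    rcases hw.2 with h | h | h | h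
    · exact (hxd _ j).trans (h ▸ hre)
    · exact (hxd _ j).trans (h ▸ hre)
    · exact (hyd _ j).trans (h ▸ him)
    · exact (hyd _ j).trans (h ▸ him)
  have hFlow : ∀ k, ∀ w ∈ rectBoundary (x (p k)) (x (p k + 1)) (y (q k)) (y (q k + 1)),
      Real.exp (-(D' * ‖w‖ ^ ω)) ≤ ‖F w‖ := fun k w hw =>
    hFD w (hnorm w (hcell k w hw.1).2.2) (hsep k w hw)
  have hS0 : ∀ w ∈ {w : ℂ | w.im < -(c₀ / 4)}, S w ≠ 0 := fun w hw =>
    norm_pos_iff.1 ((Real.exp_pos _).trans_le (hSD w (le_of_lt hw)))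
  have hcell_bound : ∀ k, ∀ w ∈ rectBoundary (x (p k)) (x (p k + 1)) (y (q k)) (y (q k + 1)), ∀ z,
      ‖Complex.exp (-Complex.I * σ * w) / S w / F w * dslope F w z‖ ≤
        2 * M * ‖Λ k‖ ^ (-γ) * Real.exp (c * ‖z‖ ^ γ) := fun k w hw z => by
    obtain ⟨h1, h2, h3⟩ := hcell k w hw.1
    have ht : 0 < ‖Λ k‖ := hc₀.trans_le (hΛ k)
    have hFw := hFlow k w hw
    have hSw := hSD w (by linarith)
    have hpow : (1 + ‖w‖) ^ ω ≤ 2 ^ ω * (1 + ‖Λ k‖) ^ ω := by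
      rw [← Real.mul_rpow zero_le_two (by positivity)]
      gcongr
      linarith
    have hpow1 : (1 + ‖w‖) ^ γ ≤ (1 + ‖w‖) ^ ω := by
      gcongr
      linarith [norm_nonneg w]
    have hpow2 : ‖w‖ ^ ω ≤ (1 + ‖w‖) ^ ω := by gcongr; linarith
    have hD : ∀ d : ℝ, d * ‖w‖ ^ ω ≤ |d| * (1 + ‖w‖) ^ ω := fun d =>
      mul_le_mul (le_abs_self d) hpow2 (by positivity) (abs_nonneg d)
    have hinvexp : ∀ d : ℝ, (Real.exp (-(d * ‖w‖ ^ ω)))⁻¹ ≤ Real.exp (|d| * (1 + ‖w‖) ^ ω) :=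
      fun d => by rw [← Real.exp_neg, neg_neg, Real.exp_le_exp]; exact hD d
    have hexp : σ * w.im ≤ -(σ * C / 2 * ‖Λ k‖ ^ β) := by
      have := hdom k
      nlinarith
    calc ‖Complex.exp (-Complex.I * σ * w) / S w / F w * dslope F w z‖
        = Real.exp (σ * w.im) * ‖S w‖⁻¹ * ‖F w‖⁻¹ * ‖dslope F w z‖ := by
          rw [norm_mul, norm_div, norm_div, norm_exp_neg_I_mul, div_eq_mul_inv, div_eq_mul_inv]
      _ ≤ Real.exp (-(σ * C / 2 * ‖Λ k‖ ^ β)) * Real.exp (|D| * (1 + ‖w‖) ^ ω) *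
          Real.exp (|D'| * (1 + ‖w‖) ^ ω) *
          (2 * Real.exp (c * (1 + ‖w‖) ^ ω) * Real.exp (c * ‖z‖ ^ γ)) := by
        gcongr
        · exact (inv_anti₀ (Real.exp_pos _) hSw).trans (hinvexp D)
        · exact (inv_anti₀ (Real.exp_pos _) hFw).trans (hinvexp D')
        · refine (norm_dslope_le hF hc hγ.le hFc w z).trans ?_
          gcongr
      _ = 2 * Real.exp ((c + |D| + |D'|) * (1 + ‖w‖) ^ ω - σ * C / 2 * ‖Λ k‖ ^ β) *
          Real.exp (c * ‖z‖ ^ γ) := by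
        have : (c + |D| + |D'|) * (1 + ‖w‖) ^ ω - σ * C / 2 * ‖Λ k‖ ^ β =
          -(σ * C / 2 * ‖Λ k‖ ^ β) + |D| * (1 + ‖w‖) ^ ω + |D'| * (1 + ‖w‖) ^ ω +
            c * (1 + ‖w‖) ^ ω := by ring
        rw [this, Real.exp_add, Real.exp_add, Real.exp_add]
        ring
      _ ≤ 2 * Real.exp ((c + |D| + |D'|) * 2 ^ ω * (1 + ‖Λ k‖) ^ ω - σ * C / 2 * ‖Λ k‖ ^ β) *
          Real.exp (c * ‖z‖ ^ γ) := by
        rw [mul_assoc _ (2 ^ ω)]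
        gcongr
      _ ≤ 2 * (M * ‖Λ k‖ ^ (-γ)) * Real.exp (c * ‖z‖ ^ γ) := by
        gcongr
        exact hM _ ht
      _ = _ := by ring
  obtain ⟨H, hH, hHΛ, B, hB0, hB⟩ := exists_interpolating_entire (Λ := Λ) (F := F)
    (h := fun w => Complex.exp (-Complex.I * σ * w) / S w) (U := {w : ℂ | w.im < -(c₀ / 4)})
    (E := fun k => 2 * M * ‖Λ k‖ ^ (-γ)) hc hγ.le hx hy hxL hyL hp hq hF
    (genusZeroProduct_eq_zero fun k => norm_pos_iff.1 (hc₀.trans_le (hΛ k)))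
    (fun k w hw => norm_pos_iff.1 ((Real.exp_pos _).trans_le (hFlow k w hw)))
    (isOpen_lt Complex.continuous_im continuous_const)
    (DifferentiableOn.div (by fun_prop) hS.differentiableOn hS0)
    (fun k w hw => by
      have := (hcell k w hw).2.2
      simp only [Set.mem_ofPred_eq]
      linarith)
    (hs.mul_left _) (fun k => by positivity) hcell_bound
  exact ⟨H, hH, hHΛ, B, c, hB0, hc, hB⟩

/-- There is a function of exponential type at most `σ` that decays on the real line like the
exponential of a power and is not small in the lower half plane. -/
theorem exists_decaying_entire {σ ν ω y₀ : ℝ} (hσ : 0 < σ) (hν : 0 < ν) (hνω : ν < ω) (hω1 : ω ≤ 1)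
    (hy : 0 < y₀) : ∃ S : ℂ → ℂ, Differentiable ℂ S ∧ (∀ z, ‖S z‖ ≤ Real.exp (σ * ‖z‖)) ∧
      (∃ D : ℝ, ∀ w : ℂ, w.im ≤ -y₀ → Real.exp (-(D * ‖w‖ ^ ω)) ≤ ‖S w‖) ∧
      ∃ b : ℝ, 0 < b ∧ ∀ x : ℝ, ‖S x‖ ≤ Real.exp (1 - b * |x| ^ ν) := by
  obtain ⟨τ, hντ, hτω⟩ := exists_between hνω
  have hτ : 0 < τ := hν.trans hντ
  have hsum : ∀ s : ℝ, 1 < s → Summable fun k : ℕ => ((k : ℝ) + 1) ^ (-s) := fun s hs => by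
    have := (summable_nat_add_iff 1).2 (Real.summable_nat_rpow.2 (by linarith : -s < -1))
    exact_mod_cast this
  have h1 : 1 < ν⁻¹ := (one_lt_inv₀ hν).2 (by linarith)
  set s₁ := ∑' k : ℕ, ((k : ℝ) + 1) ^ (-ν⁻¹) with hs₁
  have hs₁0 : 0 < s₁ := (hsum _ h1).tsum_pos (fun k => by positivity) 0 (by positivity)
  set A := σ / s₁ with hA
  have hA0 : 0 < A := by positivity
  set a : ℕ → ℝ := fun k => A * ((k : ℝ) + 1) ^ (-ν⁻¹) with ha_def
  have ha : ∀ k, 0 < a k := fun k => by positivity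
  have hs : Summable a := (hsum _ h1).mul_left A
  have hsum_eq : ∑' k, a k = σ := by
    rw [ha_def, tsum_mul_left, ← hs₁, hA, div_mul_cancel₀ _ hs₁0.ne']
  have hsτ : Summable fun k => a k ^ τ := by
    have h2 : 1 < ν⁻¹ * τ := by rw [inv_mul_eq_div]; exact (one_lt_div hν).2 hντ
    refine ((hsum _ h2).mul_left (A ^ τ)).congr fun k => ?_
    rw [ha_def, Real.mul_rpow hA0.le (by positivity), ← Real.rpow_mul (by positivity), neg_mul]
  refine ⟨expQuotProduct a, differentiable_expQuotProduct ha hs, fun z => ?_,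
    exists_le_norm_expQuotProduct ha hs hτ (by linarith) hτω hy hsτ,
    (A / (2 * Real.exp 1)) ^ ν, by positivity, norm_expQuotProduct_ofReal_le hν hA0 hs⟩
  rw [← hsum_eq]
  exact norm_expQuotProduct_le ha hs z

theorem integrable_norm_sq_of_norm_mul_le {g : ℝ → ℂ} (hg : Continuous g) {Q : ℝ}
    (h : ∀ x, ‖g x‖ * (1 + |x|) ≤ Q) : Integrable (fun x => ‖g x‖ ^ 2) := by
  refine (integrable_inv_one_add_sq.const_mul (Q ^ 2)).mono'
    (hg.norm.pow 2).aestronglyMeasurable (ae_of_all _ fun x => ?_)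
  rw [Real.norm_of_nonneg (by positivity), ← div_eq_mul_inv, le_div_iff₀ (by positivity)]
  have h1 : (‖g x‖ * (1 + |x|)) ^ 2 ≤ Q ^ 2 := by
    have := h x
    gcongr
  refine le_trans ?_ h1
  rw [mul_pow]
  gcongr
  nlinarith [sq_abs x, abs_nonneg x]

end

/-- interpolation in `PW_σ` on a sequence contained in the domain
`{z : Im z < 0, -Im z ≥ C |z|^β}` whose counting function satisfies `n(r) ≤ K r^α`
with `0 < α < min(β,1)`. -/
theorem pw_interpolation_wider_domain (σ C K α β : ℝ)
    (hσ : 0 < σ) (hC : 0 < C) (hK : 0 < K)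
    (hβ : 0 < β) (hα0 : 0 < α) (hαβ : α < β) (hα1 : α < 1)
    (Λ : ℕ → ℂ)
    (hdom : ∀ k, (Λ k).im < 0 ∧ C * ‖Λ k‖ ^ β ≤ -(Λ k).im)
    (hcount : ∀ r : ℝ, 0 < r → {k : ℕ | ‖Λ k‖ ≤ r}.Finite ∧
      ({k : ℕ | ‖Λ k‖ ≤ r}.ncard : ℝ) ≤ K * r ^ α) :
    ∃ g : ℂ → ℂ, MemPW σ g ∧ g 0 = 0 ∧
      ∀ k, g (Λ k) = Λ k * Complex.exp (-Complex.I * σ * Λ k) := by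
  obtain ⟨ω, hαω, hω⟩ := exists_between (lt_min hαβ hα1)
  obtain ⟨ν, hαν, hνω⟩ := exists_between hαω
  obtain ⟨γ, hαγ, hγν⟩ := exists_between hαν
  have hωβ : ω < β := hω.trans_le (min_le_left _ _)
  have hω1 : ω < 1 := hω.trans_le (min_le_right _ _)
  have hγ : 0 < γ := hα0.trans hαγ
  obtain ⟨c₀, hc₀, him⟩ := exists_pos_le_neg_im hC hβ hdom (hcount 1 one_pos).1
  have hΛ : ∀ k, c₀ ≤ ‖Λ k‖ := fun k =>
    (him k).trans ((neg_le_abs _).trans (Complex.abs_im_le_norm _))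
  have hs := summable_rpow_neg_of_ncard_le hK hαγ hγ hc₀ hΛ hcount
  obtain ⟨S, hS, hSσ, ⟨D, hSD⟩, b, hb, hSb⟩ := exists_decaying_entire (ν := ν) (ω := ω)
    (y₀ := c₀ / 4) hσ (hγ.trans hγν) hνω hω1.le (by positivity)
  obtain ⟨H, hH, hHΛ, B, c, hB, hc, hHB⟩ := exists_entire_eq_exp_div hσ hC hγ (by linarith)
    (hγν.trans hνω) hωβ hc₀ him (fun k => (hdom k).2) hs hS hSD
  have hd : Differentiable ℂ fun z => z * S z * H z := (differentiable_id.mul hS).mul hH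
  refine ⟨fun z => z * S z * H z, ⟨hd, fun ε hε => ?_, ?_⟩, by simp, fun k => ?_⟩
  · obtain ⟨M, hM⟩ := exists_mul_one_add_rpow_le (q := 1) hγ (by linarith) hc (half_pos hε)
    refine ⟨2 / ε * B * Real.exp M + 1, by positivity, fun z => ?_⟩
    have h1 : ‖z‖ ≤ 2 / ε * Real.exp (ε / 2 * ‖z‖) := by
      have := Real.add_one_le_exp (ε / 2 * ‖z‖)
      rw [div_mul_eq_mul_div, le_div_iff₀ hε]
      linarith
    have h2 : c * ‖z‖ ^ γ ≤ ε / 2 * ‖z‖ + M := by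
      have h3 := hM ‖z‖ (norm_nonneg z)
      rw [Real.rpow_one] at h3
      refine le_trans ?_ h3
      gcongr
      linarith
    calc ‖z * S z * H z‖ = ‖z‖ * ‖S z‖ * ‖H z‖ := by rw [norm_mul, norm_mul]
      _ ≤ (2 / ε * Real.exp (ε / 2 * ‖z‖)) * Real.exp (σ * ‖z‖) *
          (B * Real.exp (ε / 2 * ‖z‖ + M)) := by
        gcongr
        · exact hSσ z
        · exact (hHB z).trans (by gcongr)
      _ = 2 / ε * B * Real.exp M * Real.exp ((σ + ε) * ‖z‖) := by
        have : (σ + ε) * ‖z‖ = ε / 2 * ‖z‖ + σ * ‖z‖ + ε / 2 * ‖z‖ := by ring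
        rw [this, Real.exp_add, Real.exp_add, Real.exp_add]
        ring
      _ ≤ _ := by gcongr; linarith
  · obtain ⟨M, hM⟩ := exists_mul_one_add_rpow_le (A := c + 2 / γ) hγ hγν (by positivity) hb
    refine integrable_norm_sq_of_norm_mul_le (g := fun x : ℝ => (x : ℂ) * S x * H x)
      (Q := B * Real.exp (1 + M)) (hd.continuous.comp Complex.continuous_ofReal) fun x => ?_
    have h1 : 1 + |x| ≤ Real.exp ((1 + |x|) ^ γ / γ) :=
      (one_add_le_exp_rpow (abs_nonneg x) hγ (by linarith)).trans (by gcongr; linarith)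
    have h2 := hHB x
    rw [Complex.norm_real, Real.norm_eq_abs] at h2
    calc ‖(x : ℂ) * S x * H x‖ * (1 + |x|) = |x| * ‖S x‖ * ‖H x‖ * (1 + |x|) := by
          rw [norm_mul, norm_mul, Complex.norm_real, Real.norm_eq_abs]
      _ ≤ Real.exp ((1 + |x|) ^ γ / γ) * Real.exp (1 - b * |x| ^ ν) *
          (B * Real.exp (c * (1 + |x|) ^ γ)) * Real.exp ((1 + |x|) ^ γ / γ) := by
        gcongr
        · linarith
        · exact hSb x
        · refine h2.trans ?_
          gcongr
          linarith
      _ = B * Real.exp (1 + ((c + 2 / γ) * (1 + |x|) ^ γ - b * |x| ^ ν)) := by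
        have : 1 + ((c + 2 / γ) * (1 + |x|) ^ γ - b * |x| ^ ν) = (1 + |x|) ^ γ / γ +
          (1 - b * |x| ^ ν) + c * (1 + |x|) ^ γ + (1 + |x|) ^ γ / γ := by ring
        rw [this, Real.exp_add, Real.exp_add, Real.exp_add]
        ring
      _ ≤ _ := by
        gcongr
        linarith [hM |x| (abs_nonneg x)]
  · have h0 : S (Λ k) ≠ 0 :=
      norm_pos_iff.1 ((Real.exp_pos _).trans_le (hSD _ (by linarith [him k])))
    simp only [hHΛ]
    field_simp
end
end

section
/- For every nonzero complex number z one has |cos z| ≥ |Im z| / (2·|z|). -/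
theorem Real.sq_le_sinh_sq (y : ℝ) : y ^ 2 ≤ Real.sinh y ^ 2 := by
  rw [sq_le_sq, Real.abs_sinh]
  exact Real.self_le_sinh_iff.2 (abs_nonneg y)

theorem Complex.sq_norm_cos (z : ℂ) :
    ‖Complex.cos z‖ ^ 2 = Real.cos z.re ^ 2 + Real.sinh z.im ^ 2 := by
  have h : Complex.cos z =
      ⟨Real.cos z.re * Real.cosh z.im, -(Real.sin z.re * Real.sinh z.im)⟩ := by
    rw [Complex.cos_eq, ← Complex.ofReal_cos, ← Complex.ofReal_sin, ← Complex.ofReal_cosh,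
      ← Complex.ofReal_sinh]
    apply Complex.ext <;> simp [-Complex.ofReal_cos, -Complex.ofReal_sin, -Complex.ofReal_cosh,
      -Complex.ofReal_sinh]
  rw [h, Complex.sq_norm, Complex.normSq_mk]
  linear_combination Real.cos z.re ^ 2 * Real.cosh_sq z.im +
    Real.sinh z.im ^ 2 * Real.sin_sq_add_cos_sq z.re

/-- for every nonzero complex `z`, `|cos z| ≥ |Im z| / (2 |z|)`. -/
theorem abs_cos_ge (z : ℂ) (hz : z ≠ 0) :
    |z.im| / (2 * ‖z‖) ≤ ‖Complex.cos z‖ := by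
  have hpos : 0 < ‖z‖ := norm_pos_iff.2 hz
  rw [div_le_iff₀ (by positivity)]
  refine abs_le_of_sq_le_sq ?_ (by positivity)
  have hnorm : ‖z‖ ^ 2 = z.re ^ 2 + z.im ^ 2 := by
    rw [Complex.sq_norm, Complex.normSq_apply]; ring
  have hsinh := Real.sq_le_sinh_sq z.im
  rw [mul_pow, mul_pow, Complex.sq_norm_cos, hnorm]
  rcases le_total (1 / 4) (z.re ^ 2 + z.im ^ 2) with h | h
  · nlinarith [sq_nonneg (Real.cos z.re), sq_nonneg z.im]
  · have hcos : 1 / 2 ≤ Real.cos z.re := by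
      nlinarith [Real.one_sub_sq_div_two_le_cos (x := z.re), sq_nonneg z.im]
    have hcos_sq : 1 / 4 ≤ Real.cos z.re ^ 2 := by nlinarith
    nlinarith [sq_nonneg z.re, sq_nonneg z.im, sq_nonneg (Real.sinh z.im)]
end

section
/- Let (λ_k)_{k≥1} be nonzero complex numbers with counting function n(t) = #{k : |λ_k| ≤ t}, and suppose ξ(t) = ∫_t^∞ n(u)/u² du is finite for all t > 0. Then there exists A > 0 such that for every z ∈ ℂ with |z| ≥ 1 satisfying |z − λ_k| ≥ 1 and |z + λ_k| ≥ 1 for all k, the product ∏_{k≥1} (1 − z²/λ_k²) converges and log|∏_{k≥1} (1 − z²/λ_k²)| ≥ −A·( |z|·ξ(2|z|) + n(2|z|)·log(2|z|) ). -/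
open MeasureTheory

theorem sum_inv_norm_le_integral_counting {ι : Type*} (v : ι → ℝ)
    (hfin : ∀ t : ℝ, {k | v k ≤ t}.Finite) {R : ℝ} (hR : 0 < R)
    (hint : IntegrableOn (fun u => ({k | v k ≤ u}.ncard : ℝ) / u ^ 2) (Set.Ioi R))
    (F : Finset ι) (hF : ∀ k ∈ F, R < v k) :
    ∑ k ∈ F, (v k)⁻¹ ≤ ∫ u in Set.Ioi R, ({k | v k ≤ u}.ncard : ℝ) / u ^ 2 := by
  classical
  have hI : ∀ k ∈ F, IntegrableOn (fun u : ℝ => u ^ (-2 : ℝ)) (Set.Ioi (v k)) := fun k hk =>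
    integrableOn_Ioi_rpow_of_lt (by norm_num) (hR.trans (hF k hk))
  have hind : ∀ k ∈ F, IntegrableOn
      ((Set.Ioi (v k)).indicator (fun u : ℝ => u ^ (-2 : ℝ))) (Set.Ioi R) := fun k hk =>
    ((integrable_indicator_iff measurableSet_Ioi).2 (hI k hk)).integrableOn
  have heq : ∀ k ∈ F, (v k)⁻¹ =
      ∫ u in Set.Ioi R, (Set.Ioi (v k)).indicator (fun u : ℝ => u ^ (-2 : ℝ)) u := by
    intro k hk
    rw [setIntegral_indicator measurableSet_Ioi,
      Set.inter_eq_right.2 (Set.Ioi_subset_Ioi (hF k hk).le),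
      integral_Ioi_rpow_of_lt (by norm_num) (hR.trans (hF k hk))]
    norm_num [Real.rpow_neg_one]
  rw [Finset.sum_congr rfl heq, ← integral_finsetSum F hind]
  refine setIntegral_mono_on (integrable_finsetSum F hind) hint measurableSet_Ioi ?_
  intro u hu
  have hu0 : 0 < u := hR.trans hu
  have hterm : ∀ k ∈ F, (Set.Ioi (v k)).indicator (fun u : ℝ => u ^ (-2 : ℝ)) u =
      if v k < u then 1 / u ^ 2 else 0 := by
    intro k _
    simp only [Set.indicator_apply, Set.mem_Ioi]
    congr 1
    rw [Real.rpow_neg hu0.le, one_div]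
    norm_num
  rw [Finset.sum_congr rfl hterm, ← Finset.sum_filter, Finset.sum_const, nsmul_eq_mul,
    mul_one_div]
  have hcard : (F.filter (fun k => v k < u)).card ≤ {k | v k ≤ u}.ncard := by
    rw [← Set.ncard_coe_finset]
    refine Set.ncard_le_ncard ?_ (hfin u)
    intro k hk
    simp only [Finset.coe_filter, Set.mem_ofPred_eq] at hk
    exact hk.2.le
  gcongr

theorem exp_neg_two_mul_log_le_norm_one_sub_sq_div {z w : ℂ} (hz : 1 ≤ ‖z‖) (hw0 : w ≠ 0)
    (hsub : 1 ≤ ‖z - w‖) (hadd : 1 ≤ ‖z + w‖) (hw : ‖w‖ ≤ 2 * ‖z‖) :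
    Real.exp (-(2 * Real.log (2 * ‖z‖))) ≤ ‖1 - z ^ 2 / w ^ 2‖ := by
  have hw' : 0 < ‖w‖ := norm_pos_iff.2 hw0
  have hpos : 0 < 2 * ‖z‖ := by linarith
  have hfac : 1 - z ^ 2 / w ^ 2 = -((z - w) * (z + w) / w ^ 2) := by
    field_simp
    ring
  have hexp : Real.exp (-(2 * Real.log (2 * ‖z‖))) = 1 / (2 * ‖z‖) ^ 2 := by
    rw [Real.exp_neg, two_mul (Real.log _), Real.exp_add, Real.exp_log hpos, ← sq, one_div]
  rw [hfac, norm_neg, norm_div, norm_mul, norm_pow, hexp]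
  gcongr
  nlinarith

theorem exp_neg_mul_inv_le_norm_one_sub_sq_div {z w : ℂ} (hw0 : w ≠ 0)
    (hw : 2 * ‖z‖ < ‖w‖) :
    Real.exp (-(‖z‖ * ‖w‖⁻¹)) ≤ ‖1 - z ^ 2 / w ^ 2‖ := by
  have hw' : 0 < ‖w‖ := norm_pos_iff.2 hw0
  set x := ‖z‖ * ‖w‖⁻¹ with hx
  have hx0 : 0 ≤ x := by positivity
  have hx1 : x ≤ 1 / 2 := by
    rw [hx, ← div_eq_mul_inv, div_le_iff₀ hw']
    linarith
  have h1 : 1 - x ^ 2 ≤ ‖1 - z ^ 2 / w ^ 2‖ := by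
    have := norm_sub_norm_le (1 : ℂ) (z ^ 2 / w ^ 2)
    rwa [norm_one, norm_div, norm_pow, norm_pow, ← div_pow, div_eq_mul_inv] at this
  refine le_trans ?_ h1
  have h2 : Real.exp (-x) ≤ (1 + x)⁻¹ := by
    rw [Real.exp_neg]
    gcongr
    linarith [Real.add_one_le_exp x]
  refine h2.trans ?_
  rw [inv_le_iff_one_le_mul₀ (by positivity)]
  nlinarith [mul_nonneg hx0 (sub_nonneg.2 hx1), mul_nonneg hx0 (sq_nonneg x)]

theorem summable_inv_sq_of_integrableOn_counting {ι : Type*} (v : ι → ℝ)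
    (hfin : ∀ t : ℝ, {k | v k ≤ t}.Finite)
    (hint : IntegrableOn (fun u => ({k | v k ≤ u}.ncard : ℝ) / u ^ 2) (Set.Ioi 1)) :
    Summable (fun k => (v k ^ 2)⁻¹) := by
  classical
  have hsum : Summable (fun k => if 1 < v k then (v k)⁻¹ else 0) := by
    refine summable_of_sum_le
      (c := ∫ u in Set.Ioi 1, ({k | v k ≤ u}.ncard : ℝ) / u ^ 2) (fun k => ?_) (fun F => ?_)
    · dsimp only [Pi.zero_apply]
      split_ifs with h
      · exact inv_nonneg.2 (by linarith)
      · exact le_rfl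
    · rw [← Finset.sum_filter]
      exact sum_inv_norm_le_integral_counting v hfin one_pos hint _
        fun k hk => (Finset.mem_filter.1 hk).2
  refine hsum.of_norm_bounded_eventually ?_
  refine (hfin 1).subset fun k hk => ?_
  by_contra hlt
  have h1 : 1 < v k := not_le.1 hlt
  refine hk ?_
  change ‖(v k ^ 2)⁻¹‖ ≤ if 1 < v k then (v k)⁻¹ else 0
  rw [if_pos h1, Real.norm_of_nonneg (by positivity)]
  exact inv_anti₀ (by linarith) (by nlinarith)


noncomputable section

/-- product-estimate lemma. If `z` stays at distance at least `1` from all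
`±λ_k` and `|z| ≥ 1`, then `∏ (1 - z²/λ_k²)` converges and
`log |∏ (1 - z²/λ_k²)| ≥ -A (|z| ξ(2|z|) + n(2|z|) log(2|z|))` where
`ξ(t) = ∫_t^∞ n(u)/u² du`. -/
theorem canonical_product_lower_bound (Λ : ℕ → ℂ) (hΛ0 : ∀ k, Λ k ≠ 0)
    (nfun : ℝ → ℝ)
    (hnfin : ∀ t : ℝ, {k : ℕ | ‖Λ k‖ ≤ t}.Finite)
    (hn : ∀ t : ℝ, nfun t = ({k : ℕ | ‖Λ k‖ ≤ t}.ncard : ℝ))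
    (hξint : ∀ t > (0 : ℝ), MeasureTheory.IntegrableOn (fun u => nfun u / u ^ 2) (Set.Ioi t)) :
    ∃ A > (0 : ℝ), ∀ z : ℂ, 1 ≤ ‖z‖ →
      (∀ k, 1 ≤ ‖z - Λ k‖ ∧ 1 ≤ ‖z + Λ k‖) →
      Multipliable (fun k : ℕ => 1 - z ^ 2 / (Λ k) ^ 2) ∧
      -A * (‖z‖ * (∫ u in Set.Ioi (2 * ‖z‖), nfun u / u ^ 2) +
          nfun (2 * ‖z‖) * Real.log (2 * ‖z‖)) ≤
        Real.log ‖∏' k : ℕ, (1 - z ^ 2 / (Λ k) ^ 2)‖ := by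
  classical
  obtain rfl : nfun = fun t => ({k : ℕ | ‖Λ k‖ ≤ t}.ncard : ℝ) := funext hn
  refine ⟨2, two_pos, fun z hz hsep => ?_⟩
  have hmul : Multipliable (fun k : ℕ => 1 - z ^ 2 / (Λ k) ^ 2) := by
    simp_rw [sub_eq_add_neg]
    refine multipliable_one_add_of_summable ?_
    refine ((summable_inv_sq_of_integrableOn_counting (fun k => ‖Λ k‖) hnfin
      (hξint 1 one_pos)).mul_left (‖z‖ ^ 2)).congr fun k => ?_
    rw [norm_neg, norm_div, norm_pow, norm_pow, div_eq_mul_inv]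
  refine ⟨hmul, ?_⟩
  have hR : 0 < 2 * ‖z‖ := by linarith
  have hlog : 0 ≤ Real.log (2 * ‖z‖) := Real.log_nonneg (by linarith)
  have hfinite : ∀ F : Finset ℕ,
      Real.exp (-2 * (‖z‖ * (∫ u in Set.Ioi (2 * ‖z‖), ({k : ℕ | ‖Λ k‖ ≤ u}.ncard : ℝ) / u ^ 2) +
        ({k : ℕ | ‖Λ k‖ ≤ 2 * ‖z‖}.ncard : ℝ) * Real.log (2 * ‖z‖))) ≤
      ∏ k ∈ F, ‖1 - z ^ 2 / (Λ k) ^ 2‖ := by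
    intro F
    have hfar := sum_inv_norm_le_integral_counting (fun k => ‖Λ k‖) hnfin hR (hξint _ hR)
      (F.filter fun k => ¬ ‖Λ k‖ ≤ 2 * ‖z‖) fun k hk => not_le.1 (Finset.mem_filter.1 hk).2
    have hnear : ((F.filter fun k => ‖Λ k‖ ≤ 2 * ‖z‖).card : ℝ) ≤
        ({k : ℕ | ‖Λ k‖ ≤ 2 * ‖z‖}.ncard : ℝ) := by
      rw [← Set.ncard_coe_finset]
      exact_mod_cast Set.ncard_le_ncard
        (fun k hk => (Finset.mem_filter.1 (Finset.mem_coe.1 hk)).2) (hnfin _)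
    set ξ := ∫ u in Set.Ioi (2 * ‖z‖), ({k : ℕ | ‖Λ k‖ ≤ u}.ncard : ℝ) / u ^ 2
    have hξ : 0 ≤ ξ := le_trans (Finset.sum_nonneg fun k _ => by positivity) hfar
    let b : ℕ → ℝ := fun k =>
      if ‖Λ k‖ ≤ 2 * ‖z‖ then 2 * Real.log (2 * ‖z‖) else ‖z‖ * ‖Λ k‖⁻¹
    have hb : ∑ k ∈ F, b k ≤ 2 * (‖z‖ * ξ +
        ({k : ℕ | ‖Λ k‖ ≤ 2 * ‖z‖}.ncard : ℝ) * Real.log (2 * ‖z‖)) := by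
      simp only [b]
      rw [Finset.sum_ite, Finset.sum_const, nsmul_eq_mul, ← Finset.mul_sum]
      have h1 := mul_le_mul_of_nonneg_left hfar (norm_nonneg z)
      have h2 := mul_le_mul_of_nonneg_right hnear hlog
      have h3 := mul_nonneg (norm_nonneg z) hξ
      linarith
    calc _ ≤ Real.exp (∑ k ∈ F, -b k) := by
          rw [Finset.sum_neg_distrib]
          exact Real.exp_le_exp.2 (by linarith)
      _ = ∏ k ∈ F, Real.exp (-b k) := Real.exp_sum _ _
      _ ≤ ∏ k ∈ F, ‖1 - z ^ 2 / (Λ k) ^ 2‖ := by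
          refine Finset.prod_le_prod (fun _ _ => (Real.exp_pos _).le) fun k _ => ?_
          simp only [b]
          split_ifs with h
          · exact exp_neg_two_mul_log_le_norm_one_sub_sq_div hz (hΛ0 k) (hsep k).1 (hsep k).2 h
          · exact exp_neg_mul_inv_le_norm_one_sub_sq_div (hΛ0 k) (not_le.1 h)
  have hlim := ge_of_tendsto' hmul.hasProd.norm hfinite
  rwa [Real.le_log_iff_exp_le ((Real.exp_pos _).trans_le hlim)]
end
end

section
/- Let a > 1, let w : [a,∞) → (0,∞) be continuous and increasing, let C > 0, let ψ(t) = C·∫_a^t (w(u)/u) du for t ≥ a, assume ψ is unbounded, and assume γ(t) = ∫_t^∞ w(u)/u² du < ∞ for all t ≥ a. Then for every R with 2R ≥ a, Σ_{k ∈ ℕ, k ≥ ψ(2R)} 1/ψ^{−1}(k) ≤ 1/(2R) + C·γ(2R), where ψ^{−1} denotes the inverse function of ψ. -/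
open MeasureTheory

noncomputable section

/-- On `[s, t]` with `0 < s`, the weight `1 / t` is at most `1 / u`. -/
theorem integral_div_div_le_integral_div_sq {w : ℝ → ℝ} {s t : ℝ} (hs : 0 < s) (hst : s ≤ t)
    (hw : ContinuousOn w (Set.Icc s t)) (hpos : ∀ u ∈ Set.Icc s t, 0 ≤ w u) :
    (∫ u in s..t, w u / u) / t ≤ ∫ u in s..t, w u / u ^ 2 := by
  have hne : ∀ u ∈ Set.Icc s t, u ≠ 0 := fun u hu => (hs.trans_le hu.1).ne'
  rw [← intervalIntegral.integral_div]
  refine intervalIntegral.integral_mono_on hst ?_ ?_ fun u hu => ?_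
  · apply ContinuousOn.intervalIntegrable_of_Icc hst
    exact (hw.div continuousOn_id hne).div_const t
  · apply ContinuousOn.intervalIntegrable_of_Icc hst
    exact hw.div (continuousOn_id.pow 2) fun u hu => pow_ne_zero 2 (hne u hu)
  · have hu0 : 0 < u := hs.trans_le hu.1
    rw [div_div, sq]
    exact div_le_div_of_nonneg_left (hpos u hu) (mul_pos hu0 hu0)
      (mul_le_mul_of_nonneg_left hu.2 hu0.le)

/-- The natural numbers above a real threshold, enumerated from its ceiling. -/
def natGeEquiv (y : ℝ) : ℕ ≃ {k : ℕ // y ≤ (k : ℝ)} where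
  toFun i := ⟨⌈y⌉₊ + i, Nat.ceil_le.mp (Nat.le_add_right _ _)⟩
  invFun k := k - ⌈y⌉₊
  left_inv i := Nat.add_sub_cancel_left _ i
  right_inv k := Subtype.ext (Nat.add_sub_cancel' (Nat.ceil_le.mpr k.2))

/-- the tail-sum estimate `Σ_{k ≥ ψ(2R)} 1/ψ⁻¹(k) ≤ 1/(2R) + C γ(2R)` for
the auxiliary functions of the Luxemburg–Korevaar construction. -/
theorem psi_inverse_tail_sum (a : ℝ) (ha : 1 < a) (w : ℝ → ℝ)
    (hwpos : ∀ u ≥ a, 0 < w u) (hwcont : ContinuousOn w (Set.Ici a))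
    (hwmono : MonotoneOn w (Set.Ici a))
    (C : ℝ) (hC : 0 < C)
    (ψ : ℝ → ℝ) (hψ : ∀ t ≥ a, ψ t = C * ∫ u in a..t, w u / u)
    (hψunb : ∀ M : ℝ, ∃ t ≥ a, M < ψ t)
    (γ : ℝ → ℝ)
    (hγint : ∀ t ≥ a, MeasureTheory.IntegrableOn (fun u => w u / u ^ 2) (Set.Ioi t))
    (hγ : ∀ t ≥ a, γ t = ∫ u in Set.Ioi t, w u / u ^ 2)
    (ψinv : ℝ → ℝ)
    (hψinv : ∀ y ≥ (0 : ℝ), a ≤ ψinv y ∧ ψ (ψinv y) = y) :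
    ∀ R : ℝ, a ≤ 2 * R →
      Summable (fun k : {k : ℕ // ψ (2 * R) ≤ (k : ℝ)} => 1 / ψinv ((k : ℕ) : ℝ)) ∧
      (∑' k : {k : ℕ // ψ (2 * R) ≤ (k : ℝ)}, 1 / ψinv ((k : ℕ) : ℝ)) ≤
        1 / (2 * R) + C * γ (2 * R) := by
  intro R hR
  have ha0 : 0 < a := one_pos.trans ha
  have hcont : ∀ s t, a ≤ s → ContinuousOn w (Set.Icc s t) := fun s t hs =>
    hwcont.mono fun u hu => hs.trans hu.1
  have hdiv : ∀ s t, a ≤ s → s ≤ t →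
      IntervalIntegrable (fun u => w u / u) volume s t := fun s t hs hst =>
    ContinuousOn.intervalIntegrable_of_Icc hst
      ((hcont s t hs).div continuousOn_id fun u hu => (ha0.trans_le (hs.trans hu.1)).ne')
  have hsq : ∀ s t, a ≤ s → s ≤ t →
      IntervalIntegrable (fun u => w u / u ^ 2) volume s t := fun s t hs hst =>
    (intervalIntegrable_iff_integrableOn_Ioc_of_le hst).mpr
      ((hγint s hs).mono_set Set.Ioc_subset_Ioi_self)
  have hsub : ∀ s t, a ≤ s → s ≤ t → ψ t - ψ s = C * ∫ u in s..t, w u / u := by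
    intro s t hs hst
    rw [hψ t (hs.trans hst), hψ s hs, ← mul_sub,
      intervalIntegral.integral_interval_sub_left (hdiv a t le_rfl (hs.trans hst))
        (hdiv a s le_rfl hs)]
  have hmono : StrictMonoOn ψ (Set.Ici a) := by
    intro s hs t _ hst
    have hpos : 0 < ∫ u in s..t, w u / u :=
      intervalIntegral.intervalIntegral_pos_of_pos_on (hdiv s t hs hst.le)
        (fun u hu => div_pos (hwpos u (le_trans hs hu.1.le))
          (ha0.trans_le (le_trans hs hu.1.le))) hst
    have := hsub s t hs hst.le
    have := mul_pos hC hpos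
    linarith
  have hstep : ∀ s t, a ≤ s → s ≤ t →
      (ψ t - ψ s) / t ≤ C * ∫ u in s..t, w u / u ^ 2 := by
    intro s t hs hst
    rw [hsub s t hs hst, mul_div_assoc]
    exact mul_le_mul_of_nonneg_left
      (integral_div_div_le_integral_div_sq (ha0.trans_le hs) hst (hcont s t hs)
        fun u hu => (hwpos u (hs.trans hu.1)).le) hC.le
  set T := 2 * R
  have hT0 : 0 < T := ha0.trans_le hR
  set x : ℕ → ℝ := fun i => ψinv ((⌈ψ T⌉₊ + i : ℕ) : ℝ)
  have hxa : ∀ i, a ≤ x i := fun i => (hψinv _ (Nat.cast_nonneg _)).1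
  have hψx : ∀ i, ψ (x i) = ((⌈ψ T⌉₊ + i : ℕ) : ℝ) := fun i =>
    (hψinv _ (Nat.cast_nonneg _)).2
  have hTx : ∀ i, T ≤ x i := fun i => by
    rw [← hmono.le_iff_le hR (hxa i), hψx]
    exact Nat.ceil_le.mp (Nat.le_add_right _ _)
  have hxx : ∀ i, x i ≤ x (i + 1) := fun i => by
    rw [← hmono.le_iff_le (hxa i) (hxa (i + 1)), hψx, hψx]
    exact_mod_cast Nat.le_succ _
  have hpartial : ∀ n, ∑ i ∈ Finset.range (n + 1), 1 / x i ≤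
      1 / T + C * ∫ u in T..x n, w u / u ^ 2 := by
    intro n
    induction n with
    | zero =>
      have hnonneg : 0 ≤ ∫ u in T..x 0, w u / u ^ 2 :=
        intervalIntegral.integral_nonneg (hTx 0) fun u hu =>
          div_nonneg (hwpos u (hR.trans hu.1)).le (sq_nonneg u)
      have h1 : 1 / x 0 ≤ 1 / T := one_div_le_one_div_of_le hT0 (hTx 0)
      have := mul_nonneg hC.le hnonneg
      simp only [zero_add, Finset.sum_range_one]
      linarith
    | succ n ih =>
      rw [Finset.sum_range_succ, ← intervalIntegral.integral_add_adjacent_intervals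
        (hsq T (x n) hR (hTx n)) (hsq (x n) (x (n + 1)) (hxa n) (hxx n)), mul_add]
      have h := hstep (x n) (x (n + 1)) (hxa n) (hxx n)
      have hone : ψ (x (n + 1)) - ψ (x n) = 1 := by
        rw [hψx, hψx]
        push_cast
        ring
      rw [hone] at h
      linarith
  have hxnonneg : ∀ i, 0 ≤ 1 / x i := fun i =>
    one_div_nonneg.mpr (ha0.le.trans (hxa i))
  have hbound : ∀ n, ∑ i ∈ Finset.range n, 1 / x i ≤ 1 / T + C * γ T := by
    intro n
    have htail : ∫ u in T..x n, w u / u ^ 2 ≤ γ T := by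
      rw [hγ T hR, intervalIntegral.integral_of_le (hTx n)]
      refine setIntegral_mono_set (hγint T hR) ?_ Set.Ioc_subset_Ioi_self.eventuallyLE
      filter_upwards [ae_restrict_mem measurableSet_Ioi] with u hu
      exact div_nonneg (hwpos u (hR.trans (le_of_lt hu))).le (sq_nonneg u)
    have := mul_le_mul_of_nonneg_left htail hC.le
    have := hpartial n
    rw [Finset.sum_range_succ] at this
    linarith [hxnonneg n]
  constructor
  · rw [← (natGeEquiv (ψ T)).summable_iff]
    exact summable_of_sum_range_le hxnonneg hbound
  · rw [← (natGeEquiv (ψ T)).tsum_eq]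
    exact Real.tsum_le_of_sum_range_le hxnonneg hbound
end
end

section
/- Let (z_j)_{j≥1} be nonzero complex numbers and (r_j)_{j≥1} positive reals with Σ_{j≥1} r_j/|z_j| < ∞, and let A > 0. Then there exists a strictly increasing unbounded sequence (h_k)_{k≥0} of positive reals with h_k + 2 ≤ h_{k+1} ≤ 2·h_k for all k ≥ 0, such that for every k the horizontal segment {x − i·h_k : x ∈ ℝ, |x| ≤ h_k/A} is disjoint from every closed disk {z : |z − z_j| ≤ r_j}, j ≥ 1. -/
/-- The horizontal segment `{x - i t : |x| ≤ t / A}` avoids the closed disks `|w - z j| ≤ r j`. -/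
def SegmentAvoids (z : ℕ → ℂ) (r : ℕ → ℝ) (A t : ℝ) : Prop :=
  ∀ x : ℝ, |x| ≤ t / A → ∀ j, r j < ‖(x : ℂ) - (t : ℂ) * Complex.I - z j‖

/-- If countably many closed intervals have total half-length less than `(b - a) / 2`,
they do not cover `[a, b]`. -/
lemma exists_mem_Icc_forall_lt_dist (c ρ : ℕ → ℝ) (hρ : ∀ j, 0 ≤ ρ j) (hs : Summable ρ)
    {a b : ℝ} (hab : 2 * ∑' j, ρ j < b - a) :
    ∃ t ∈ Set.Icc a b, ∀ j, ρ j < dist t (c j) := by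
  by_contra! hcon
  have hsub : Set.Icc a b ⊆ ⋃ j, Metric.closedBall (c j) (ρ j) := fun t ht => by
    obtain ⟨j, hj⟩ := hcon t ht
    exact Set.mem_iUnion.2 ⟨j, hj⟩
  have hle : ENNReal.ofReal (b - a) ≤ ENNReal.ofReal (∑' j, 2 * ρ j) := by
    calc ENNReal.ofReal (b - a) = MeasureTheory.volume (Set.Icc a b) := Real.volume_Icc.symm
      _ ≤ MeasureTheory.volume (⋃ j, Metric.closedBall (c j) (ρ j)) :=
        MeasureTheory.measure_mono hsub
      _ ≤ ∑' j, MeasureTheory.volume (Metric.closedBall (c j) (ρ j)) :=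
        MeasureTheory.measure_iUnion_le _
      _ = ∑' j, ENNReal.ofReal (2 * ρ j) := by simp only [Real.volume_closedBall]
      _ = ENNReal.ofReal (∑' j, 2 * ρ j) :=
        (ENNReal.ofReal_tsum_of_nonneg (fun j => by linarith [hρ j]) (hs.mul_left 2)).symm
  rw [tsum_mul_left,
    ENNReal.ofReal_le_ofReal_iff (mul_nonneg zero_le_two (tsum_nonneg hρ))] at hle
  linarith

/-- For a family of disks of finite view, every interval `[T + 2, 2 T]` with `T` large
contains an admissible height. -/
lemma exists_segmentAvoids_mem_Icc (z : ℕ → ℂ) (r : ℕ → ℝ)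
    (hz0 : ∀ j, z j ≠ 0) (hr : ∀ j, 0 < r j)
    (hsum : Summable fun j => r j / ‖z j‖) (A : ℝ) (hA : 0 < A) :
    ∃ T₀ : ℝ, 4 < T₀ ∧ ∀ T, T₀ ≤ T → ∃ t ∈ Set.Icc (T + 2) (2 * T), SegmentAvoids z r A t := by
  obtain ⟨C, hC⟩ : ∃ C : ℝ, C = 1 + 1 / A := ⟨_, rfl⟩
  have hC1 : 1 < C := by
    have : 0 < 1 / A := by positivity
    linarith
  have hq : ∀ j, 0 ≤ r j / ‖z j‖ := fun j => div_nonneg (hr j).le (norm_nonneg _)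
  obtain ⟨N, hN⟩ : ∃ N : ℕ, ∑' j, r (j + N) / ‖z (j + N)‖ < 1 / (16 * C) :=
    ((tendsto_sum_nat_add fun j => r j / ‖z j‖).eventually_lt_const
      (show (0 : ℝ) < 1 / (16 * C) by positivity)).exists
  have htail : Summable fun j => r (j + N) / ‖z (j + N)‖ :=
    (summable_nat_add_iff (f := fun j => r j / ‖z j‖) N).2 hsum
  have hnn : ∀ j, 0 ≤ ‖z j‖ + r j := fun j => add_nonneg (norm_nonneg _) (hr j).le
  refine ⟨5 + ∑ j ∈ Finset.range N, (‖z j‖ + r j), ?_, fun T hT => ?_⟩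
  · linarith [Finset.sum_nonneg fun j (_ : j ∈ Finset.range N) => hnn j]
  have hT5 : 5 ≤ T := by
    linarith [Finset.sum_nonneg fun j (_ : j ∈ Finset.range N) => hnn j]
  obtain ⟨t, ht, hdist⟩ := exists_mem_Icc_forall_lt_dist (fun j => -(z (j + N)).im)
    (fun j => 4 * C * T * (r (j + N) / ‖z (j + N)‖))
    (fun j => mul_nonneg (by positivity) (hq _)) (htail.mul_left _)
    (a := T + 2) (b := 2 * T) (by
      rw [tsum_mul_left]
      rw [lt_div_iff₀ (by positivity)] at hN
      nlinarith)
  refine ⟨t, ht, fun x hx j => ?_⟩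
  obtain ⟨ht1, ht2⟩ := ht
  have ht0 : 0 < t := by linarith
  set w : ℂ := (x : ℂ) - (t : ℂ) * Complex.I with hw
  have hwim : w.im = -t := by simp [hw]
  have hwlow : t ≤ ‖w‖ := by
    have := Complex.abs_im_le_norm w
    rwa [hwim, abs_neg, abs_of_pos ht0] at this
  have hwup : ‖w‖ ≤ C * t := by
    calc ‖w‖ ≤ ‖(x : ℂ)‖ + ‖(t : ℂ) * Complex.I‖ := norm_sub_le _ _
      _ = |x| + t := by simp [abs_of_pos ht0]
      _ ≤ t / A + t := by linarith
      _ = C * t := by rw [hC]; ring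
  rcases lt_or_ge j N with hj | hj
  · have := Finset.single_le_sum (fun i _ => hnn i) (Finset.mem_range.2 hj)
    linarith [norm_sub_norm_le w (z j)]
  · obtain ⟨i, rfl⟩ : ∃ i, j = i + N := ⟨j - N, by omega⟩
    have hzpos : 0 < ‖z (i + N)‖ := norm_pos_iff.2 (hz0 _)
    by_contra! hcon
    have hhalf : r (i + N) ≤ 1 / 2 * ‖z (i + N)‖ := by
      rw [← div_le_iff₀ hzpos]
      calc r (i + N) / ‖z (i + N)‖ ≤ ∑' j, r (j + N) / ‖z (j + N)‖ :=
            htail.le_tsum i fun j _ => hq _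
        _ ≤ 1 / (16 * C) := hN.le
        _ ≤ 1 / 2 := one_div_le_one_div_of_le two_pos (by linarith)
    have hzle : ‖z (i + N)‖ ≤ 4 * C * T := by
      have h1 := norm_sub_norm_le (z (i + N)) w
      rw [norm_sub_rev _ w] at h1
      nlinarith
    have h2 : r (i + N) ≤ 4 * C * T * (r (i + N) / ‖z (i + N)‖) := by
      rw [← mul_div_assoc, le_div_iff₀ hzpos, mul_comm]
      exact mul_le_mul_of_nonneg_right hzle (hr _).le
    have h3 : dist t (-(z (i + N)).im) ≤ ‖w - z (i + N)‖ := by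
      have := Complex.abs_im_le_norm (w - z (i + N))
      rw [Complex.sub_im, hwim, ← abs_neg] at this
      rw [Real.dist_eq]
      convert this using 2
      ring
    linarith [hdist i]

/-- for a family of disks of finite view (`Σ r_j/|z_j| < ∞`) and `A > 0`,
there is a strictly increasing unbounded sequence of heights `h_k` with
`h_k + 2 ≤ h_{k+1} ≤ 2 h_k` such that each horizontal segment
`{x - i h_k : |x| ≤ h_k / A}` avoids all the closed disks `{z : |z - z_j| ≤ r_j}`. -/
theorem heights_avoiding_disks (z : ℕ → ℂ) (r : ℕ → ℝ)
    (hz0 : ∀ j, z j ≠ 0) (hr : ∀ j, 0 < r j)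
    (hsum : Summable fun j => r j / ‖z j‖) (A : ℝ) (hA : 0 < A) :
    ∃ h : ℕ → ℝ, (∀ k, 0 < h k) ∧ StrictMono h ∧
      Filter.Tendsto h Filter.atTop Filter.atTop ∧
      (∀ k, h k + 2 ≤ h (k + 1) ∧ h (k + 1) ≤ 2 * h k) ∧
      ∀ k, ∀ x : ℝ, |x| ≤ h k / A → ∀ j,
        r j < ‖(x : ℂ) - (h k : ℂ) * Complex.I - z j‖ := by
  obtain ⟨T₀, hT₀, hex⟩ := exists_segmentAvoids_mem_Icc z r hz0 hr hsum A hA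
  choose! f hf hgood using hex
  have hge : ∀ k, T₀ ≤ f^[k] T₀ := fun k => by
    induction k with
    | zero => exact le_rfl
    | succ k ih =>
      rw [Function.iterate_succ_apply']
      linarith [(hf _ ih).1]
  have hstep : ∀ k, f^[k] T₀ + 2 ≤ f^[k + 1] T₀ ∧ f^[k + 1] T₀ ≤ 2 * f^[k] T₀ := fun k => by
    rw [Function.iterate_succ_apply']
    exact hf _ (hge k)
  have hlin : ∀ k : ℕ, (k : ℝ) ≤ f^[k] T₀ := fun k => by
    induction k with
    | zero => simpa using (by linarith : (0 : ℝ) ≤ T₀)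
    | succ k ih =>
      push_cast
      linarith [(hstep k).1]
  refine ⟨fun k => f^[k + 1] T₀, fun k => by linarith [hge (k + 1)],
    strictMono_nat_of_lt_succ fun k => by linarith [(hstep (k + 1)).1],
    Filter.tendsto_atTop_mono (fun k => ?_) tendsto_natCast_atTop_atTop,
    fun k => hstep (k + 1), fun k => ?_⟩
  · linarith [hlin k, (hstep k).1]
  · simp only [Function.iterate_succ_apply']
    exact hgood _ (hge k)
end

section
/- Let σ > 0 and let g : ℂ → ℂ be an entire function of exponential type at most σ whose restriction to ℝ is square-integrable, and suppose g(0) = 0. Then the function h defined by h(z) = g(z)/z for z ≠ 0 and h(0) = g'(0) is entire, has exponential type at most σ, and its restriction to ℝ is square-integrable. -/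
open MeasureTheory

noncomputable section

/-- division property of the Paley–Wiener space: if `g ∈ PW_σ` and
`g(0) = 0`, then `h(z) = g(z)/z` (with `h(0) = g'(0)`) is entire, of exponential type at
most `σ`, and square-integrable on the real line. -/
theorem pw_division (σ : ℝ) (hσ : 0 < σ) (g : ℂ → ℂ)
    (hg : Differentiable ℂ g) (htype : ExpTypeLE σ g)
    (hL2 : MeasureTheory.Integrable fun x : ℝ => ‖g x‖ ^ 2)
    (hg0 : g 0 = 0)
    (h : ℂ → ℂ) (hhne : ∀ z : ℂ, z ≠ 0 → h z = g z / z) (hh0 : h 0 = deriv g 0) :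
    Differentiable ℂ h ∧ ExpTypeLE σ h ∧
      MeasureTheory.Integrable fun x : ℝ => ‖h x‖ ^ 2 := by
  obtain rfl : h = dslope g 0 := by
    funext z
    rcases eq_or_ne z 0 with rfl | hz
    · rw [hh0, dslope_same]
    · rw [hhne z hz, dslope_of_ne g hz, slope_def_field, hg0, sub_zero, sub_zero]
  have hd : Differentiable ℂ (dslope g 0) := by
    rw [← differentiableOn_univ] at hg ⊢
    exact (Complex.differentiableOn_dslope Filter.univ_mem).2 hg
  obtain ⟨M, hM⟩ := (isCompact_closedBall (0 : ℂ) 1).exists_bound_of_continuousOn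
    hd.continuous.continuousOn
  have hM_le : ∀ z : ℂ, ‖z‖ ≤ 1 → ‖dslope g 0 z‖ ≤ M := fun z hz => hM z (by simpa using hz)
  have hM0 : 0 ≤ M := (norm_nonneg _).trans (hM_le 0 (by simp))
  have hle : ∀ z : ℂ, 1 < ‖z‖ → ‖dslope g 0 z‖ ≤ ‖g z‖ := fun z hz => by
    rw [hhne z (norm_pos_iff.1 (one_pos.trans hz)), norm_div]
    exact div_le_self (norm_nonneg _) hz.le
  refine ⟨hd, fun ε hε => ?_, ?_⟩
  · obtain ⟨c, hc, hgc⟩ := htype ε hε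
    refine ⟨M + c, by positivity, fun z => ?_⟩
    rcases le_or_gt ‖z‖ 1 with hz | hz
    · have hexp : 1 ≤ Real.exp ((σ + ε) * ‖z‖) := Real.one_le_exp (by positivity)
      calc ‖dslope g 0 z‖ ≤ M + c := by linarith [hM_le z hz]
        _ ≤ (M + c) * Real.exp ((σ + ε) * ‖z‖) := le_mul_of_one_le_right (by positivity) hexp
    · refine (hle z hz).trans ((hgc z).trans ?_)
      gcongr
      linarith
  · have hind : Integrable ((Set.Icc (-1 : ℝ) 1).indicator fun _ => M ^ 2) :=
      (integrable_indicator_iff measurableSet_Icc).2 (continuousOn_const.integrableOn_Icc)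
    have hcont : Continuous fun x : ℝ => ‖dslope g 0 x‖ ^ 2 :=
      ((hd.continuous.comp Complex.continuous_ofReal).norm).pow 2
    refine (hL2.add hind).mono' hcont.aestronglyMeasurable (Filter.Eventually.of_forall fun x => ?_)
    rw [Real.norm_of_nonneg (by positivity), Pi.add_apply]
    rcases le_or_gt |x| 1 with hx | hx
    · rw [Set.indicator_of_mem (Set.mem_Icc.2 (abs_le.1 hx))]
      have hbound := pow_le_pow_left₀ (norm_nonneg _) (hM_le x (by simpa using hx)) 2
      have hsq := sq_nonneg ‖g x‖
      linarith
    · rw [Set.indicator_of_notMem fun hmem => hx.not_ge (abs_le.2 (Set.mem_Icc.1 hmem)), add_zero]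
      exact pow_le_pow_left₀ (norm_nonneg _) (hle x (by simpa using hx)) 2
end
end

section
/- Let Λ be a countable set of nonzero complex numbers with Σ_{λ∈Λ} 1/|λ| < ∞, let r > 0, and let V_r = ∪_{λ∈Λ} {z : |z − λ| ≤ r}. Let U be a connected component of V_r such that Λ ∩ U is nonempty, let λ_0 be an element of Λ ∩ U of minimal modulus, and let N = #(Λ ∩ U) (allowing N = ∞). Then Σ_{λ ∈ Λ ∩ U} 1/|λ| ≥ (1/(2r))·log(1 + 2rN/|λ_0|); in particular N is finite and N ≤ (|λ_0|/(2r))·(exp(2r·Σ_{λ∈Λ} 1/|λ|) − 1). -/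
noncomputable section

/-- A point of a connected component of a union of closed balls lies in one of the balls whose
centre belongs to that component. -/
theorem exists_center_mem_connectedComponentIn {Λ : Set ℂ} {r : ℝ} (hr : 0 ≤ r) {z₀ z : ℂ}
    (hz : z ∈ connectedComponentIn (⋃ lam ∈ Λ, Metric.closedBall lam r) z₀) :
    ∃ lam ∈ Λ ∩ connectedComponentIn (⋃ lam ∈ Λ, Metric.closedBall lam r) z₀,
      dist z lam ≤ r := by
  obtain ⟨lam, hlam, hzl⟩ := Set.mem_iUnion₂.1 (connectedComponentIn_subset _ _ hz)
  refine ⟨lam, ⟨hlam, ?_⟩, hzl⟩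
  rw [connectedComponentIn_eq hz]
  exact (convex_closedBall lam r).isPreconnected.subset_connectedComponentIn hzl
    (Set.subset_biUnion_of_mem (u := fun lam => Metric.closedBall lam r) hlam)
    (Metric.mem_closedBall_self hr)

/-- The moduli of the elements of a set of nonzero complex numbers with summable inverses attain
their minimum on every nonempty subset. -/
theorem exists_norm_le_of_summable_inv_norm {Λ : Set ℂ} (hΛ0 : ∀ lam ∈ Λ, lam ≠ 0)
    (hsum : Summable fun lam : Λ => 1 / ‖(lam : ℂ)‖) {s : Set ℂ} (hs : s ⊆ Λ)
    (hne : s.Nonempty) : ∃ a ∈ s, ∀ b ∈ s, ‖a‖ ≤ ‖b‖ := by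
  have ht : Filter.Tendsto (fun lam : Λ => ‖(lam : ℂ)‖) Filter.cofinite Filter.atTop := by
    have h : Filter.Tendsto (fun lam : Λ => 1 / ‖(lam : ℂ)‖) Filter.cofinite
        (nhdsWithin 0 (Set.Ioi 0)) :=
      tendsto_nhdsWithin_iff.2 ⟨hsum.tendsto_cofinite_zero, Filter.Eventually.of_forall
        fun lam => one_div_pos.2 (norm_pos_iff.2 (hΛ0 lam lam.2))⟩
    simpa [Function.comp_def] using tendsto_inv_nhdsGT_zero.comp h
  obtain ⟨b, hb⟩ := hne
  obtain ⟨a, ha, hmin⟩ := ht.exists_within_forall_le (s := Subtype.val ⁻¹' s) ⟨⟨b, hs hb⟩, hb⟩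
  exact ⟨a, ha, fun c hc => hmin ⟨c, hs hc⟩ hc⟩

/-- The elementary comparison behind `∑ 1 / (a + j d) ≥ (1 / d) log (1 + n d / a)`. -/
theorem log_one_add_succ_le {a d x : ℝ} (ha : 0 < a) (hd : 0 < d) (hx : 0 < x) (k : ℕ)
    (hxk : x ≤ a + d * k) :
    (1 / d) * Real.log (1 + d * ((k + 1 : ℕ) : ℝ) / a) ≤
      (1 / d) * Real.log (1 + d * (k : ℝ) / a) + 1 / x := by
  have hp : 0 < a + d * k := by positivity
  have h1 : 0 < 1 + d * (k : ℝ) / a := by positivity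
  have h2 : 0 < 1 + d * ((k + 1 : ℕ) : ℝ) / a := by positivity
  have h := Real.log_le_sub_one_of_pos (div_pos h2 h1)
  rw [Real.log_div h2.ne' h1.ne'] at h
  have he : (1 + d * ((k + 1 : ℕ) : ℝ) / a) / (1 + d * (k : ℝ) / a) - 1 = d / (a + d * k) := by
    push_cast
    field_simp
    ring
  have hle : d / (a + d * k) ≤ d / x := by gcongr
  have hlog : Real.log (1 + d * ((k + 1 : ℕ) : ℝ) / a) ≤
      Real.log (1 + d * (k : ℝ) / a) + d / x := by linarith
  calc _ ≤ (1 / d) * (Real.log (1 + d * (k : ℝ) / a) + d / x) := by gcongr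
    _ = _ := by field_simp

/-- Let `A` be the set of centres in a preconnected set `U` which is covered by the closed balls of
radius `r` around `A`. If the moduli of `S ⊆ A` are at most `M`, then some element of `A \ S` has
modulus at most `M + 2 * r`. -/
theorem exists_mem_diff_norm_le {A U S : Set ℂ} {r M : ℝ} (hr : 0 < r) (hAU : A ⊆ U)
    (hU : IsPreconnected U) (hcover : ∀ z ∈ U, ∃ lam ∈ A, dist z lam ≤ r)
    (hmin : ∃ a ∈ A \ S, ∀ b ∈ A \ S, ‖a‖ ≤ ‖b‖)
    (hS : ∀ s ∈ S, ‖s‖ ≤ M) (hne : (A ∩ S).Nonempty) :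
    ∃ a ∈ A \ S, ‖a‖ ≤ M + 2 * r := by
  obtain ⟨a, ha, hmin⟩ := hmin
  refine ⟨a, ha, ?_⟩
  by_contra! hlt
  obtain ⟨s, hsA, hsS⟩ := hne
  have hsM := hS s hsS
  obtain ⟨z, hzU, hz⟩ := hU.intermediate_value (hAU hsA) (hAU ha.1)
    continuous_norm.continuousOn
    (show (M + ‖a‖) / 2 ∈ Set.Icc ‖s‖ ‖a‖ from ⟨by linarith, by linarith⟩)
  obtain ⟨lam, hlam, hd⟩ := hcover z hzU
  rw [dist_eq_norm] at hd
  by_cases h : lam ∈ S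
  · linarith [hS lam h, norm_sub_norm_le z lam]
  · linarith [hmin lam ⟨hlam, h⟩, norm_sub_norm_le lam z, norm_sub_rev z lam]

/-- Every cardinality up to that of `Λ ∩ U` is attained by a finite subset whose inverse moduli
have at least logarithmically large sum. -/
theorem exists_finset_log_le_sum_inv_norm {Λ : Set ℂ} (hΛ0 : ∀ lam ∈ Λ, lam ≠ 0)
    (hsum : Summable fun lam : Λ => 1 / ‖(lam : ℂ)‖) {r : ℝ} (hr : 0 < r) {U : Set ℂ}
    (hU : IsPreconnected U) (hcover : ∀ z ∈ U, ∃ lam ∈ Λ ∩ U, dist z lam ≤ r)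
    {lam₀ : ℂ} (hlam₀ : lam₀ ∈ Λ ∩ U) (k : ℕ) (hk : (k : ℕ∞) ≤ (Λ ∩ U).encard) :
    ∃ S : Finset ℂ, (S : Set ℂ) ⊆ Λ ∩ U ∧ S.card = k ∧
      (∀ s ∈ S, ‖s‖ ≤ ‖lam₀‖ + 2 * r * k - 2 * r) ∧
      (1 / (2 * r)) * Real.log (1 + 2 * r * (k : ℝ) / ‖lam₀‖) ≤ ∑ s ∈ S, 1 / ‖s‖ := by
  classical
  induction k with
  | zero => exact ⟨∅, by simp⟩
  | succ k ih =>
    obtain ⟨S, hSA, hcard, hS, hlog⟩ := ih (le_trans (by exact_mod_cast k.le_succ) hk)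
    obtain ⟨a, ha, hale⟩ : ∃ a ∈ (Λ ∩ U) \ S, ‖a‖ ≤ ‖lam₀‖ + 2 * r * k := by
      by_cases h0 : lam₀ ∈ S
      · have hne : ((Λ ∩ U) \ S).Nonempty := by
          rw [Set.nonempty_iff_ne_empty, Ne, Set.sdiff_eq_empty]
          intro hsub
          have h := hk.trans (Set.encard_le_encard hsub)
          rw [Set.encard_coe_eq_coe_finsetCard, hcard] at h
          have : k + 1 ≤ k := by exact_mod_cast h
          omega
        obtain ⟨a, ha, hle⟩ := exists_mem_diff_norm_le hr Set.inter_subset_right hU hcover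
          (exists_norm_le_of_summable_inv_norm hΛ0 hsum
            (Set.sdiff_subset.trans Set.inter_subset_left) hne) hS ⟨lam₀, hlam₀, h0⟩
        exact ⟨a, ha, by linarith⟩
      · exact ⟨lam₀, ⟨hlam₀, h0⟩, le_add_of_nonneg_right (by positivity)⟩
    have haS : a ∉ S := ha.2
    refine ⟨insert a S, ?_, ?_, ?_, ?_⟩
    · rw [Finset.coe_insert]
      exact Set.insert_subset ha.1 hSA
    · rw [Finset.card_insert_of_notMem haS, hcard]
    · intro s hs
      push_cast
      rcases Finset.mem_insert.1 hs with rfl | hs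
      · linarith
      · linarith [hS s hs]
    · rw [Finset.sum_insert haS]
      linarith [log_one_add_succ_le (norm_pos_iff.2 (hΛ0 _ hlam₀.1)) (by positivity : 0 < 2 * r)
        (norm_pos_iff.2 (hΛ0 a ha.1.1)) k hale]

/-- Inverting the logarithmic bound. -/
theorem le_of_log_one_add_le {a d x T : ℝ} (ha : 0 < a) (hd : 0 < d) (hx : 0 ≤ x)
    (h : (1 / d) * Real.log (1 + d * x / a) ≤ T) : x ≤ (a / d) * (Real.exp (d * T) - 1) := by
  have hlog : Real.log (1 + d * x / a) ≤ d * T := by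
    rw [one_div, inv_mul_le_iff₀ hd] at h
    exact h
  rw [Real.log_le_iff_le_exp (by positivity)] at hlog
  calc x = (a / d) * (d * x / a) := by field_simp
    _ ≤ _ := by gcongr; linarith

/-- the clustering estimate. If `Σ_{λ∈Λ} 1/|λ| < ∞` and `U` is a connected
component of the closed `r`-neighborhood `V_r` of `Λ`, with `λ₀ ∈ Λ ∩ U` of minimal
modulus and `N = #(Λ ∩ U)`, then `Σ_{λ ∈ Λ ∩ U} 1/|λ| ≥ (1/(2r)) log(1 + 2rN/|λ₀|)`;
in particular `N` is finite and `N ≤ (|λ₀|/(2r)) (exp(2r Σ_{λ∈Λ} 1/|λ|) − 1)`. -/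
theorem clustering_estimate (Λ : Set ℂ) (hcount : Λ.Countable)
    (hΛ0 : ∀ lam ∈ Λ, lam ≠ 0)
    (hsum : Summable fun lam : Λ => 1 / ‖(lam : ℂ)‖)
    (r : ℝ) (hr : 0 < r)
    (U : Set ℂ)
    (hU : ∃ z₀ ∈ ⋃ lam ∈ Λ, Metric.closedBall lam r,
      U = connectedComponentIn (⋃ lam ∈ Λ, Metric.closedBall lam r) z₀)
    (lam₀ : ℂ) (hlam₀ : lam₀ ∈ Λ ∩ U)
    (hmin : ∀ lam ∈ Λ ∩ U, ‖lam₀‖ ≤ ‖lam‖) :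
    (Λ ∩ U).Finite ∧
    (1 / (2 * r)) * Real.log (1 + 2 * r * ((Λ ∩ U).ncard : ℝ) / ‖lam₀‖) ≤
      (∑' lam : ↥(Λ ∩ U), 1 / ‖(lam : ℂ)‖) ∧
    ((Λ ∩ U).ncard : ℝ) ≤ (‖lam₀‖ / (2 * r)) *
      (Real.exp (2 * r * ∑' lam : Λ, 1 / ‖(lam : ℂ)‖) - 1) := by
  have hU' : IsPreconnected U ∧ ∀ z ∈ U, ∃ lam ∈ Λ ∩ U, dist z lam ≤ r := by
    obtain ⟨z₀, -, rfl⟩ := hU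
    exact ⟨isPreconnected_connectedComponentIn,
      fun z hz => exists_center_mem_connectedComponentIn hr.le hz⟩
  have hpos : 0 < ‖lam₀‖ := norm_pos_iff.2 (hΛ0 _ hlam₀.1)
  have key := exists_finset_log_le_sum_inv_norm hΛ0 hsum hr hU'.1 hU'.2 hlam₀
  have hle : ∀ S : Finset ℂ, (S : Set ℂ) ⊆ Λ →
      ∑ s ∈ S, 1 / ‖s‖ ≤ ∑' lam : Λ, 1 / ‖(lam : ℂ)‖ := by
    classical
    intro S hS
    rw [← Finset.sum_subtype_of_mem (p := (· ∈ Λ)) (fun s : ℂ => 1 / ‖s‖) fun s hs => hS hs]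
    exact hsum.sum_le_tsum _ fun _ _ => by positivity
  have hbound : ∀ k : ℕ, (k : ℕ∞) ≤ (Λ ∩ U).encard → (k : ℝ) ≤ (‖lam₀‖ / (2 * r)) *
      (Real.exp (2 * r * ∑' lam : Λ, 1 / ‖(lam : ℂ)‖) - 1) := by
    intro k hk
    obtain ⟨S, hSA, -, -, hlog⟩ := key k hk
    exact le_of_log_one_add_le hpos (by positivity) k.cast_nonneg
      (hlog.trans (hle S (hSA.trans Set.inter_subset_left)))
  have hfin : (Λ ∩ U).Finite := by
    by_contra hinf
    obtain ⟨k, hk⟩ := exists_nat_gt ((‖lam₀‖ / (2 * r)) *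
      (Real.exp (2 * r * ∑' lam : Λ, 1 / ‖(lam : ℂ)‖) - 1))
    exact hk.not_ge (hbound k (by simp [Set.Infinite.encard_eq hinf]))
  refine ⟨hfin, ?_, hbound _ hfin.cast_ncard_eq.le⟩
  obtain ⟨S, hSA, hcard, -, hlog⟩ := key _ hfin.cast_ncard_eq.le
  have hS : (S : Set ℂ) = Λ ∩ U :=
    Set.eq_of_subset_of_ncard_le hSA (by rw [Set.ncard_coe_finset, hcard]) hfin
  refine hlog.trans (le_of_eq ?_)
  rw [← hS]
  exact (Finset.tsum_subtype' S fun s : ℂ => 1 / ‖s‖).symm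
end
end
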